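/- arXiv:1202.5630 — 2 statements merged into one kernel-verified Lean document; each statement's English description precedes it below -/
import Mathlib

section
/- Let c(n) be the coefficients of the q-expansion η(4τ)²η(8τ)² = Σ_{n≥1} c(n)q^n. Then Σ_{n≥1} c(n)/n² = (π/8) ∫₀¹ x/√(1 − x⁴) · log((1 + x)/(1 − x)) dx, where the integral on the right converges absolutely. -/
open MeasureTheory Set

/-- The Dedekind eta function `η(τ) = q^{1/24} ∏_{m≥1} (1 - q^m)` with
`q = exp(2πiτ)`, defined for `τ` in the upper half-plane. -/
noncomputable def dedekindEta (τ : ℂ) : ℂ :=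
  Complex.exp (2 * Real.pi * Complex.I * τ / 24) *
    ∏' m : ℕ, (1 - Complex.exp (2 * Real.pi * Complex.I * τ) ^ (m + 1))

section

open Filter Topology

/-- The finite product `(Q; Q)_n = ∏_{k=1}^n (1 - Q^k)`. -/
noncomputable def qFactorial (Q : ℝ) (n : ℕ) : ℝ := ∏ k ∈ Finset.range n, (1 - Q ^ (k + 1))

/-- The infinite product `(Q; Q)_∞ = ∏_{k≥1} (1 - Q^k)`. -/
noncomputable def eulerProduct (Q : ℝ) : ℝ := ∏' k : ℕ, (1 - Q ^ (k + 1))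

/-- The Gaussian binomial coefficients, defined through the `q`-Pascal rule. -/
noncomputable def gaussianBinomial (Q : ℝ) : ℕ → ℕ → ℝ
  | _, 0 => 1
  | 0, _ + 1 => 0
  | M + 1, j + 1 => gaussianBinomial Q M (j + 1) + Q ^ (M - j) * gaussianBinomial Q M j

lemma gaussianBinomial_eq_zero (Q : ℝ) {M j : ℕ} (h : M < j) : gaussianBinomial Q M j = 0 := by
  induction M generalizing j with
  | zero =>
    obtain ⟨i, rfl⟩ := Nat.exists_eq_succ_of_ne_zero (by omega : j ≠ 0)
    simp [gaussianBinomial]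
  | succ M ih =>
    obtain ⟨i, rfl⟩ := Nat.exists_eq_succ_of_ne_zero (by omega : j ≠ 0)
    simp [gaussianBinomial, ih (show M < i + 1 by omega), ih (show M < i by omega)]

lemma gaussianBinomial_mul (Q : ℝ) (a b : ℕ) :
    gaussianBinomial Q (a + b) a * qFactorial Q a * qFactorial Q b = qFactorial Q (a + b) := by
  induction hn : a + b generalizing a b with
  | zero =>
    obtain ⟨rfl, rfl⟩ : a = 0 ∧ b = 0 := by omega
    simp [gaussianBinomial, qFactorial]
  | succ n ih =>
    rcases a with _ | a
    · obtain rfl : b = n + 1 := by omega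
      simp [gaussianBinomial, qFactorial]
    have e1 : ∀ m, qFactorial Q (m + 1) = qFactorial Q m * (1 - Q ^ (m + 1)) := fun m => by
      simp [qFactorial, Finset.prod_range_succ]
    have h1 := ih a b (by omega)
    rw [gaussianBinomial, e1 n, show n - a = b by omega]
    rcases b with _ | b
    · obtain rfl : n = a := by omega
      rw [gaussianBinomial_eq_zero Q (show n < n + 1 by omega)]
      simp only [qFactorial, Finset.range_zero, Finset.prod_empty, mul_one] at h1 ⊢
      rw [Finset.prod_range_succ]
      linear_combination (1 - Q ^ (n + 1)) * h1
    · have h2 := ih (a + 1) b (by omega)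
      obtain rfl : n = a + b + 1 := by omega
      rw [e1 a, e1 b] at *
      linear_combination (1 - Q ^ (b + 1)) * h2 + Q ^ (b + 1) * (1 - Q ^ (a + 1)) * h1

lemma prod_one_add_mul_pow (Q x : ℝ) (M : ℕ) :
    ∏ k ∈ Finset.range M, (1 + x * Q ^ k)
      = ∑ j ∈ Finset.range (M + 1), Q ^ (j.choose 2) * gaussianBinomial Q M j * x ^ j := by
  induction M with
  | zero => simp [gaussianBinomial]
  | succ M ih =>
    rw [Finset.prod_range_succ, ih, mul_add, mul_one]
    conv_rhs => rw [Finset.sum_range_succ']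
    simp only [gaussianBinomial]
    have h0 : ∑ j ∈ Finset.range (M + 1), Q ^ (j.choose 2) * gaussianBinomial Q M j * x ^ j
        = ∑ j ∈ Finset.range (M + 1),
            Q ^ ((j + 1).choose 2) * gaussianBinomial Q M (j + 1) * x ^ (j + 1) + 1 := by
      have := Finset.sum_range_succ
        (fun j => Q ^ (j.choose 2) * gaussianBinomial Q M j * x ^ j) (M + 1)
      rw [Finset.sum_range_succ', gaussianBinomial_eq_zero Q (show M < M + 1 by omega)] at this
      simp only [gaussianBinomial] at this
      simp at this ⊢
      linarith
    nth_rewrite 1 [h0]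
    rw [Finset.sum_mul, add_right_comm, ← Finset.sum_add_distrib]
    congr 1
    · refine Finset.sum_congr rfl fun j hj => ?_
      rw [Finset.mem_range] at hj
      have : (j + 1).choose 2 + (M - j) = j.choose 2 + M := by
        have := Nat.choose_succ_succ' j 1
        rw [Nat.choose_one_right] at this
        norm_num at this
        omega
      have h2 : Q ^ ((j + 1).choose 2) * Q ^ (M - j) = Q ^ j.choose 2 * Q ^ M := by
        rw [← pow_add, ← pow_add, this]
      rw [pow_succ x]
      linear_combination -gaussianBinomial Q M j * x ^ j * x * h2
    · simp

lemma summable_nat_mul_pow_sq {q : ℝ} (h0 : 0 < q) (h1 : q < 1) {w : ℝ} (hw : 0 < w) :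
    Summable fun n : ℕ => ((n : ℝ) + 1) * (w ^ n * q ^ (n ^ 2)) := by
  have hg : Summable fun n : ℕ => ((n : ℝ) + 1) * (1 / 2) ^ n := by
    have h := (summable_pow_mul_geometric_of_norm_lt_one 1 (r := (1 / 2 : ℝ)) (by norm_num)).add
      (summable_geometric_of_norm_lt_one (x := (1 / 2 : ℝ)) (by norm_num))
    refine h.congr fun n => ?_
    ring
  have ht : Tendsto (fun n : ℕ => w * q ^ n) atTop (𝓝 0) := by
    simpa using (tendsto_pow_atTop_nhds_zero_of_lt_one h0.le h1).const_mul w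
  refine Summable.of_norm_bounded_eventually_nat hg ?_
  filter_upwards [ht.eventually_le_const (show (0 : ℝ) < 1 / 2 by norm_num)] with n hn
  rw [Real.norm_of_nonneg (by positivity), pow_two, pow_mul, ← mul_pow]
  gcongr

lemma summable_mul_pow_sq {q : ℝ} (h0 : 0 < q) (h1 : q < 1) {z : ℝ} (hz : z ≠ 0) :
    Summable fun n : ℤ => (|(n : ℝ)| + 1) * (|z| ^ n * q ^ (n.natAbs ^ 2)) := by
  refine Summable.of_nat_of_neg ?_ ?_
  · simpa using summable_nat_mul_pow_sq h0 h1 (abs_pos.mpr hz)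
  · simpa using summable_nat_mul_pow_sq h0 h1 (inv_pos.mpr (abs_pos.mpr hz))

lemma summable_zpow_mul_pow_sq {q : ℝ} (h0 : 0 < q) (h1 : q < 1) {z : ℝ} (hz : z ≠ 0) :
    Summable fun n : ℤ => z ^ n * q ^ (n.natAbs ^ 2) := by
  refine (summable_mul_pow_sq h0 h1 hz).of_norm_bounded fun n => ?_
  rw [norm_mul, norm_zpow, norm_pow, Real.norm_eq_abs, Real.norm_eq_abs, abs_of_pos h0]
  have : 0 ≤ |z| ^ n * q ^ (n.natAbs ^ 2) := by positivity
  nlinarith [abs_nonneg (n : ℝ)]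

lemma summable_int_mul_zpow_mul_pow_sq {q : ℝ} (h0 : 0 < q) (h1 : q < 1) {z : ℝ} (hz : z ≠ 0) :
    Summable fun n : ℤ => n * (z ^ n * q ^ (n.natAbs ^ 2)) := by
  refine (summable_mul_pow_sq h0 h1 hz).of_norm_bounded fun n => ?_
  rw [norm_mul, norm_mul, norm_zpow, norm_pow, Real.norm_eq_abs, Real.norm_eq_abs,
    Real.norm_eq_abs, abs_of_pos h0]
  have : 0 ≤ |z| ^ n * q ^ (n.natAbs ^ 2) := by positivity
  nlinarith [abs_nonneg (n : ℝ)]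

lemma qFactorial_pos {Q : ℝ} (h0 : 0 < Q) (h1 : Q < 1) (n : ℕ) : 0 < qFactorial Q n :=
  Finset.prod_pos fun k _ => by
    have := pow_lt_one₀ h0.le h1 (Nat.succ_ne_zero k); simp at this ⊢; linarith

lemma multipliable_one_sub_pow_real {Q : ℝ} (h0 : 0 < Q) (h1 : Q < 1) :
    Multipliable fun k : ℕ => (1 - Q ^ (k + 1)) := by
  simp_rw [sub_eq_add_neg]
  refine Real.multipliable_one_add_of_summable ?_
  exact ((summable_nat_add_iff 1).mpr (summable_geometric_of_lt_one h0.le h1)).neg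

lemma tendsto_qFactorial {Q : ℝ} (h0 : 0 < Q) (h1 : Q < 1) :
    Tendsto (qFactorial Q) atTop (𝓝 (eulerProduct Q)) :=
  (multipliable_one_sub_pow_real h0 h1).hasProd.tendsto_prod_nat

lemma qFactorial_antitone {Q : ℝ} (h0 : 0 < Q) (h1 : Q < 1) : Antitone (qFactorial Q) := by
  refine antitone_nat_of_succ_le fun n => ?_
  rw [qFactorial, Finset.prod_range_succ]
  refine mul_le_of_le_one_right (qFactorial_pos h0 h1 n).le ?_
  have : 0 < Q ^ (n + 1) := by positivity
  linarith

lemma eulerProduct_pos {Q : ℝ} (h0 : 0 < Q) (h1 : Q < 1) : 0 < eulerProduct Q := by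
  have hs : Summable fun k : ℕ => -Q ^ (k + 1) :=
    ((summable_nat_add_iff 1).mpr (summable_geometric_of_lt_one h0.le h1)).neg
  have hp : ∀ k : ℕ, 0 < 1 + -Q ^ (k + 1) := fun k => by
    have := pow_lt_one₀ h0.le h1 (Nat.succ_ne_zero k); simp at this ⊢; linarith
  rw [eulerProduct]
  simp_rw [sub_eq_add_neg]
  rw [← Real.rexp_tsum_eq_tprod hp (Real.summable_log_one_add_of_summable hs)]
  exact Real.exp_pos _

lemma finite_triple_product {q : ℝ} (h0 : 0 < q) {z : ℝ} (hz : z ≠ 0) (N : ℕ) :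
    ∏ k ∈ Finset.range N, ((1 + z * q ^ (2 * k + 1)) * (1 + z⁻¹ * q ^ (2 * k + 1)))
      = ∑ n ∈ Finset.Icc (-N : ℤ) N,
          z ^ n * q ^ (n.natAbs ^ 2) * gaussianBinomial (q ^ 2) (2 * N) (n + N).toNat := by
  have key := prod_one_add_mul_pow (q ^ 2) (z * q * (q ^ (2 * N))⁻¹) (2 * N)
  have hl : ∏ k ∈ Finset.range (2 * N), (1 + z * q * (q ^ (2 * N))⁻¹ * (q ^ 2) ^ k)
      = (∏ k ∈ Finset.range N, ((1 + z * q ^ (2 * k + 1)) * (1 + z⁻¹ * q ^ (2 * k + 1))))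
        * (z ^ N * (q ^ (N ^ 2))⁻¹) := by
    rw [two_mul N, Finset.prod_range_add, ← Finset.prod_range_reflect, Finset.prod_mul_distrib]
    have e1 : ∏ k ∈ Finset.range N, (1 + z * q * (q ^ (N + N))⁻¹ * (q ^ 2) ^ (N + k))
        = ∏ k ∈ Finset.range N, (1 + z * q ^ (2 * k + 1)) := by
      refine Finset.prod_congr rfl fun k _ => ?_
      field_simp
      ring
    have e3 : ∏ k ∈ Finset.range N, (z * (q ^ (2 * k + 1))⁻¹) = z ^ N * (q ^ (N ^ 2))⁻¹ := by
      rw [Finset.prod_mul_distrib, Finset.prod_const, Finset.card_range]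
      congr 1
      rw [Finset.prod_inv_distrib, Finset.prod_pow_eq_pow_sum]
      congr 2
      clear * -
      induction N with
      | zero => simp
      | succ n ih => rw [Finset.sum_range_succ, ih]; ring
    have e2 : ∏ k ∈ Finset.range N, (1 + z * q * (q ^ (N + N))⁻¹ * (q ^ 2) ^ (N - 1 - k))
        = (∏ k ∈ Finset.range N, (1 + z⁻¹ * q ^ (2 * k + 1))) * (z ^ N * (q ^ (N ^ 2))⁻¹) := by
      rw [← e3, ← Finset.prod_mul_distrib]
      refine Finset.prod_congr rfl fun k hk => ?_
      rw [Finset.mem_range] at hk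
      obtain ⟨d, rfl⟩ : ∃ d, N = k + 1 + d := ⟨N - k - 1, by omega⟩
      rw [show k + 1 + d - 1 - k = d by omega]
      field_simp
      ring
    rw [e1, e2]; ring
  rw [hl] at key
  have hne : z ^ N * (q ^ (N ^ 2))⁻¹ ≠ 0 := by positivity
  rw [← mul_left_inj' hne, key, Finset.sum_mul]
  symm
  refine Finset.sum_bij' (fun n _ => (n + N).toNat) (fun j _ => (j : ℤ) - N) ?_ ?_ ?_ ?_ ?_
  · intro n hn; rw [Finset.mem_Icc] at hn; rw [Finset.mem_range]; omega
  · intro j hj; rw [Finset.mem_range] at hj; rw [Finset.mem_Icc]; omega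
  · intro n hn; rw [Finset.mem_Icc] at hn; omega
  · intro j hj; simp
  · intro n hn
    rw [Finset.mem_Icc] at hn
    obtain ⟨j, rfl⟩ : ∃ j : ℕ, n = (j : ℤ) - N := ⟨(n + N).toNat, by omega⟩
    rw [sub_add_cancel, Int.toNat_natCast, zpow_sub₀ hz]
    have e4 : q ^ (((j : ℤ) - N).natAbs ^ 2) * q ^ (2 * N * j)= q ^ (j ^ 2) * q ^ (N ^ 2) := by
      rw [← pow_add, ← pow_add]
      congr 1
      zify
      rw [sq_abs]
      ring
    have e5 : (q ^ 2) ^ (j.choose 2) * q ^ j = q ^ (j ^ 2) := by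
      rw [← pow_mul, ← pow_add]
      congr 1
      rw [Nat.choose_two_right, Nat.mul_div_cancel' (Nat.even_mul_pred_self j).two_dvd]
      cases j with
      | zero => rfl
      | succ j => rw [Nat.add_sub_cancel]; ring
    rw [mul_pow, mul_pow, inv_pow, ← pow_mul]
    simp only [zpow_natCast]
    have e6 : (q ^ (2 * N)) ^ j = q ^ (2 * N * j) := (pow_mul _ _ _).symm
    have e7 : q ^ (2 * j.choose 2) * q ^ j = q ^ (j ^ 2) := by rw [← e5, pow_mul]
    field_simp
    rw [e6]
    linear_combination gaussianBinomial (q ^ 2) (2 * N) j * (e4 - q ^ (N ^ 2) * e7)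

lemma tendsto_sum_mul_gaussianBinomial {Q : ℝ} (h0 : 0 < Q) (h1 : Q < 1) {a : ℤ → ℝ}
    (ha : Summable a) :
    Tendsto (fun N : ℕ => ∑ n ∈ Finset.Icc (-N : ℤ) N,
      a n * gaussianBinomial Q (2 * N) (n + N).toNat) atTop
      (𝓝 ((∑' n, a n) / eulerProduct Q)) := by
  have hE := eulerProduct_pos h0 h1
  have hle : ∀ n, eulerProduct Q ≤ qFactorial Q n :=
    (qFactorial_antitone h0 h1).le_of_tendsto (tendsto_qFactorial h0 h1)
  have hgb : ∀ (n : ℤ) (N : ℕ), n ∈ Finset.Icc (-N : ℤ) N →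
      gaussianBinomial Q (2 * N) (n + N).toNat
        = qFactorial Q (2 * N) / (qFactorial Q (n + N).toNat * qFactorial Q (N - n).toNat) := by
    intro n N hn
    rw [Finset.mem_Icc] at hn
    have := gaussianBinomial_mul Q (n + N).toNat (N - n).toNat
    rw [show (n + N).toNat + (N - n).toNat = 2 * N by omega] at this
    have p1 := (qFactorial_pos h0 h1 (n + N).toNat).ne'
    have p2 := (qFactorial_pos h0 h1 (N - n).toNat).ne'
    rw [← this]
    field_simp
  rw [← tsum_div_const]
  have hrw : ∀ N : ℕ, ∑ n ∈ Finset.Icc (-N : ℤ) N,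
      a n * gaussianBinomial Q (2 * N) (n + N).toNat = ∑' n : ℤ,
        (if n ∈ Finset.Icc (-N : ℤ) N then
          a n * gaussianBinomial Q (2 * N) (n + N).toNat else 0) := by
    intro N
    rw [tsum_eq_sum (s := Finset.Icc (-N : ℤ) N)]
    · exact Finset.sum_congr rfl fun n hn => (if_pos hn).symm
    · intro n hn; exact if_neg hn
  simp_rw [hrw]
  refine tendsto_tsum_of_dominated_convergence (bound := fun n => |a n| / eulerProduct Q)
    (ha.abs.div_const _) (fun n => ?_) (Eventually.of_forall fun N n => ?_)
  · have hT := tendsto_qFactorial h0 h1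
    have t1 : Tendsto (fun N : ℕ => 2 * N) atTop atTop :=
      tendsto_atTop_mono (fun N => by simp only [id]; omega) tendsto_id
    have t2 : Tendsto (fun N : ℕ => (n + N).toNat) atTop atTop := by
      rw [tendsto_atTop_atTop]
      exact fun b => ⟨b + n.natAbs, fun N hN => by omega⟩
    have t3 : Tendsto (fun N : ℕ => ((N : ℤ) - n).toNat) atTop atTop := by
      rw [tendsto_atTop_atTop]
      exact fun b => ⟨b + n.natAbs, fun N hN => by omega⟩
    have := ((hT.comp t1).div ((hT.comp t2).mul (hT.comp t3)) (by positivity)).const_mul (a n)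
    rw [show a n * (eulerProduct Q / (eulerProduct Q * eulerProduct Q)) = a n / eulerProduct Q by
      field_simp] at this
    refine this.congr' ?_
    filter_upwards [eventually_ge_atTop n.natAbs] with N hN
    have hm : n ∈ Finset.Icc (-N : ℤ) N := by rw [Finset.mem_Icc]; omega
    rw [if_pos hm, hgb n N hm]
    rfl
  · split_ifs with hn
    · rw [norm_mul, Real.norm_eq_abs, Real.norm_eq_abs, div_eq_mul_inv, hgb n N hn]
      have p0 := qFactorial_pos h0 h1 (2 * N)
      have p1 := qFactorial_pos h0 h1 (n + N).toNat
      have p2 := qFactorial_pos h0 h1 (N - n).toNat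
      rw [abs_of_pos (a := qFactorial Q (2 * N) / _) (by positivity)]
      rw [Finset.mem_Icc] at hn
      refine mul_le_mul_of_nonneg_left ?_ (abs_nonneg _)
      rw [div_le_iff₀ (by positivity), ← div_eq_inv_mul, le_div_iff₀ hE]
      have := qFactorial_antitone h0 h1 (show (n + N).toNat ≤ 2 * N by omega)
      exact mul_le_mul this (hle _) hE.le p1.le
    · rw [norm_zero]; positivity

/-- **Jacobi's triple product identity**. -/
theorem tendsto_triple_product {q : ℝ} (h0 : 0 < q) (h1 : q < 1) {z : ℝ} (hz : z ≠ 0) :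
    Tendsto (fun N => ∏ k ∈ Finset.range N,
      ((1 + z * q ^ (2 * k + 1)) * (1 + z⁻¹ * q ^ (2 * k + 1)))) atTop
      (𝓝 ((∑' n : ℤ, z ^ n * q ^ (n.natAbs ^ 2)) / eulerProduct (q ^ 2))) := by
  simp_rw [finite_triple_product h0 hz]
  exact tendsto_sum_mul_gaussianBinomial (by positivity) (by nlinarith)
    (summable_zpow_mul_pow_sq h0 h1 hz)

/-- **Jacobi's identity** for the cube of the Euler product. -/
theorem eulerProduct_cube {q : ℝ} (h0 : 0 < q) (h1 : q < 1) :
    q * eulerProduct (q ^ 2) ^ 3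
      = -∑' n : ℤ, (n : ℝ) * ((-q⁻¹) ^ n * q ^ (n.natAbs ^ 2)) * q := by
  have hQ0 : 0 < q ^ 2 := by positivity
  have hQ1 : q ^ 2 < 1 := by nlinarith
  have hz : -q⁻¹ ≠ 0 := by simpa using h0.ne'
  have hfin : ∀ N : ℕ, q * qFactorial (q ^ 2) N * qFactorial (q ^ 2) (N + 1) =
      ∑ n ∈ Finset.Icc (-(N + 1 : ℕ) : ℤ) (N + 1 : ℕ),
        -((n : ℝ) * ((-q⁻¹) ^ n * q ^ (n.natAbs ^ 2)) * q)
          * gaussianBinomial (q ^ 2) (2 * (N + 1)) (n + (N + 1 : ℕ)).toNat := by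
    intro N
    have hr : HasDerivAt (fun z : ℝ => ∑ n ∈ Finset.Icc (-(N + 1 : ℕ) : ℤ) (N + 1 : ℕ),
        z ^ n * q ^ (n.natAbs ^ 2)
          * gaussianBinomial (q ^ 2) (2 * (N + 1)) (n + (N + 1 : ℕ)).toNat)
        (∑ n ∈ Finset.Icc (-(N + 1 : ℕ) : ℤ) (N + 1 : ℕ),
        ((n : ℝ) * (-q⁻¹) ^ (n - 1)) * q ^ (n.natAbs ^ 2)
          * gaussianBinomial (q ^ 2) (2 * (N + 1)) (n + (N + 1 : ℕ)).toNat) (-q⁻¹) :=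
      HasDerivAt.fun_sum fun n _ =>
        ((hasDerivAt_zpow n (-q⁻¹) (Or.inl hz)).mul_const _).mul_const _
    have hg : DifferentiableAt ℝ (fun z : ℝ =>
        (∏ k ∈ Finset.range N, (1 + z * q ^ (2 * (k + 1) + 1)))
          * ∏ k ∈ Finset.range (N + 1), (1 + z⁻¹ * q ^ (2 * k + 1))) (-q⁻¹) := by
      refine DifferentiableAt.mul ?_ ?_
      · fun_prop
      · refine DifferentiableAt.fun_finsetProd fun k _ => ?_
        exact ((differentiableAt_inv hz).mul_const _).const_add _
    have hl := (((hasDerivAt_id (-q⁻¹)).mul_const q).const_add 1).mul hg.hasDerivAt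
    have heq : (fun z : ℝ => ∑ n ∈ Finset.Icc (-(N + 1 : ℕ) : ℤ) (N + 1 : ℕ),
        z ^ n * q ^ (n.natAbs ^ 2)
          * gaussianBinomial (q ^ 2) (2 * (N + 1)) (n + (N + 1 : ℕ)).toNat) =ᶠ[𝓝 (-q⁻¹)]
        ((fun z : ℝ => 1 + id z * q) * fun z : ℝ =>
        (∏ k ∈ Finset.range N, (1 + z * q ^ (2 * (k + 1) + 1)))
          * ∏ k ∈ Finset.range (N + 1), (1 + z⁻¹ * q ^ (2 * k + 1))) := by
      filter_upwards [isOpen_ne.mem_nhds hz] with z hz'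
      rw [← finite_triple_product h0 hz', Finset.prod_mul_distrib, Finset.prod_range_succ']
      simp only [Pi.mul_apply, id]
      ring
    have := hr.unique (hl.congr_of_eventuallyEq heq)
    have e0 : 1 + id (-q⁻¹) * q = 0 := by simp only [id]; field_simp; ring
    have e1 : ∏ k ∈ Finset.range N, (1 + -q⁻¹ * q ^ (2 * (k + 1) + 1)) = qFactorial (q ^ 2) N := by
      refine Finset.prod_congr rfl fun k _ => ?_
      field_simp
      ring
    have e2 : ∏ k ∈ Finset.range (N + 1), (1 + (-q⁻¹)⁻¹ * q ^ (2 * k + 1))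
        = qFactorial (q ^ 2) (N + 1) := by
      refine Finset.prod_congr rfl fun k _ => ?_
      rw [inv_neg, inv_inv]
      ring
    rw [e0, e1, e2] at this
    rw [show q * qFactorial (q ^ 2) N * qFactorial (q ^ 2) (N + 1)
      = 1 * q * (qFactorial (q ^ 2) N * qFactorial (q ^ 2) (N + 1)) by ring]
    rw [zero_mul, add_zero] at this
    rw [← this]
    refine Finset.sum_congr rfl fun n _ => ?_
    rw [zpow_sub_one₀ hz]
    field_simp
  have hs := ((summable_int_mul_zpow_mul_pow_sq h0 h1 hz).mul_right q).neg
  have hlim := (tendsto_sum_mul_gaussianBinomial hQ0 hQ1 hs).comp (tendsto_add_atTop_nat 1)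
  have hT := tendsto_qFactorial hQ0 hQ1
  have hlim2 := (hT.const_mul q).mul (hT.comp (tendsto_add_atTop_nat 1))
  have := tendsto_nhds_unique (hlim2.congr hfin) hlim
  have hE := eulerProduct_pos hQ0 hQ1
  rw [eq_div_iff hE.ne', tsum_neg] at this
  linear_combination this

/-- The theta constant `θ₂(it) = ∑ₙ exp(-π(n+1/2)²t)`. -/
noncomputable def thetaTwo (t : ℝ) : ℝ := ∑' n : ℤ, Real.exp (-Real.pi * (n + 1 / 2) ^ 2 * t)

/-- The theta constant `θ₃(it) = ∑ₙ exp(-πn²t)`. -/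
noncomputable def thetaThree (t : ℝ) : ℝ := ∑' n : ℤ, Real.exp (-Real.pi * n ^ 2 * t)

/-- The theta constant `θ₄(it) = ∑ₙ (-1)ⁿ exp(-πn²t)`. -/
noncomputable def thetaFour (t : ℝ) : ℝ :=
  ∑' n : ℤ, (-1) ^ n * Real.exp (-Real.pi * n ^ 2 * t)

lemma hasSum_thetaTwo {t : ℝ} (ht : 0 < t) :
    HasSum (fun n : ℤ => Real.exp (-Real.pi * (n + 1 / 2) ^ 2 * t)) (thetaTwo t) :=
  (HurwitzZeta.hasSum_int_evenKernel (1 / 2) ht).summable.hasSum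

lemma hasSum_thetaThree {t : ℝ} (ht : 0 < t) :
    HasSum (fun n : ℤ => Real.exp (-Real.pi * n ^ 2 * t)) (thetaThree t) := by
  have := (HurwitzZeta.hasSum_int_evenKernel 0 ht).summable
  simp only [add_zero] at this
  exact this.hasSum

lemma norm_neg_one_zpow (n : ℤ) : ‖((-1 : ℝ)) ^ n‖ = 1 := by simp

lemma hasSum_thetaFour {t : ℝ} (ht : 0 < t) :
    HasSum (fun n : ℤ => (-1) ^ n * Real.exp (-Real.pi * n ^ 2 * t)) (thetaFour t) := by
  refine (Summable.of_norm_bounded (hasSum_thetaThree ht).summable fun n => ?_).hasSum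
  rw [norm_mul, norm_neg_one_zpow, one_mul, Real.norm_of_nonneg (Real.exp_pos _).le]

lemma thetaTwo_pos {t : ℝ} (ht : 0 < t) : 0 < thetaTwo t :=
  (hasSum_thetaTwo ht).summable.tsum_pos (fun _ => (Real.exp_pos _).le) 0 (Real.exp_pos _)

lemma thetaThree_pos {t : ℝ} (ht : 0 < t) : 0 < thetaThree t :=
  (hasSum_thetaThree ht).summable.tsum_pos (fun _ => (Real.exp_pos _).le) 0 (Real.exp_pos _)

lemma thetaTwo_eq_inv {t : ℝ} (ht : 0 < t) : thetaTwo t = thetaFour t⁻¹ / √t := by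
  have h1 : HurwitzZeta.evenKernel ((1 / 2 : ℝ) : UnitAddCircle) t = thetaTwo t :=
    (HurwitzZeta.hasSum_int_evenKernel (1 / 2) ht).unique (hasSum_thetaTwo ht)
  have h2 : HurwitzZeta.cosKernel ((1 / 2 : ℝ) : UnitAddCircle) t⁻¹ = thetaFour t⁻¹ := by
    have ha := HurwitzZeta.hasSum_int_cosKernel (1 / 2) (inv_pos.mpr ht)
    have hb := Complex.hasSum_ofReal.mpr (hasSum_thetaFour (inv_pos.mpr ht))
    refine Complex.ofReal_injective (ha.unique (hb.congr_fun fun n => ?_))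
    have : Complex.exp (2 * Real.pi * Complex.I * ((1 / 2 : ℝ) : ℂ) * n) = (-1) ^ n := by
      rw [← Complex.exp_pi_mul_I, ← Complex.exp_int_mul]
      congr 1; push_cast; ring
    rw [this]; push_cast; ring
  rw [← h1, HurwitzZeta.evenKernel_functional_equation, one_div t, h2, Real.sqrt_eq_rpow]
  ring

lemma thetaThree_eq_inv {t : ℝ} (ht : 0 < t) : thetaThree t = thetaThree t⁻¹ / √t := by
  have h1 : ∀ {s : ℝ}, 0 < s → HurwitzZeta.evenKernel 0 s = thetaThree s := fun {s} hs => by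
    have := HurwitzZeta.hasSum_int_evenKernel 0 hs
    simp only [add_zero] at this
    exact this.unique (hasSum_thetaThree hs)
  rw [← h1 ht, HurwitzZeta.evenKernel_functional_equation, one_div t,
    ← HurwitzZeta.evenKernel_eq_cosKernel_of_zero, h1 (inv_pos.mpr ht), Real.sqrt_eq_rpow]
  ring

lemma thetaFour_eq_inv {t : ℝ} (ht : 0 < t) : thetaFour t = thetaTwo t⁻¹ / √t := by
  rw [thetaTwo_eq_inv (inv_pos.mpr ht), inv_inv, Real.sqrt_inv]
  have := Real.sqrt_pos.mpr ht
  field_simp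

lemma thetaFour_pos {t : ℝ} (ht : 0 < t) : 0 < thetaFour t := by
  rw [thetaFour_eq_inv ht]
  exact div_pos (thetaTwo_pos (inv_pos.mpr ht)) (Real.sqrt_pos.mpr ht)

lemma tsum_eq_add_of_isCompl {α α' β : Type*} {i : α → β} {j : α' → β} (hi : i.Injective)
    (hj : j.Injective) (hc : IsCompl (range i) (range j)) {f : β → ℝ} (hf : Summable f) :
    ∑' x, f x = ∑' x, f (i x) + ∑' x, f (j x) := by
  have h1 := hi.hasSum_range_iff.mpr (hf.comp_injective hi).hasSum
  have h2 := hj.hasSum_range_iff.mpr (hf.comp_injective hj).hasSum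
  exact (h1.add_isCompl hc h2).tsum_eq

lemma tsum_int_eq_even_add_odd {f : ℤ → ℝ} (hf : Summable f) :
    ∑' n, f n = ∑' n, f (2 * n) + ∑' n, f (2 * n + 1) := by
  refine tsum_eq_add_of_isCompl (i := fun n : ℤ => 2 * n) (j := fun n : ℤ => 2 * n + 1)
    (fun a b h => by simpa using h) (fun a b h => by simpa using h) ?_ hf
  rw [isCompl_iff, disjoint_iff_forall_ne, codisjoint_iff_le_sup]
  constructor
  · rintro _ ⟨a, rfl⟩ _ ⟨b, rfl⟩; simp only; omega
  · intro n _
    rcases Int.even_or_odd' n with ⟨k, rfl | rfl⟩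
    · exact Or.inl ⟨k, rfl⟩
    · exact Or.inr ⟨k, rfl⟩

lemma tsum_int_prod_eq_rotate {f : ℤ × ℤ → ℝ} (hf : Summable f) :
    ∑' p, f p = ∑' p : ℤ × ℤ, f (p.1 + p.2, p.1 - p.2)
      + ∑' p : ℤ × ℤ, f (p.1 + p.2 + 1, p.1 - p.2) := by
  refine tsum_eq_add_of_isCompl (i := fun p : ℤ × ℤ => (p.1 + p.2, p.1 - p.2))
    (j := fun p : ℤ × ℤ => (p.1 + p.2 + 1, p.1 - p.2)) ?_ ?_ ?_ hf
  · rintro ⟨a, b⟩ ⟨c, d⟩ h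
    simp only [Prod.mk.injEq] at h ⊢; omega
  · rintro ⟨a, b⟩ ⟨c, d⟩ h
    simp only [Prod.mk.injEq] at h ⊢; omega
  rw [isCompl_iff, disjoint_iff_forall_ne, codisjoint_iff_le_sup]
  constructor
  · rintro _ ⟨⟨a, b⟩, rfl⟩ _ ⟨⟨c, d⟩, rfl⟩
    simp only [ne_eq, Prod.mk.injEq]; omega
  · rintro ⟨m, n⟩ _
    rcases Int.even_or_odd' (m + n) with ⟨k, h | h⟩
    · refine Or.inl ⟨(k, m - k), ?_⟩
      simp only [Prod.mk.injEq]; omega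
    · refine Or.inr ⟨(k, m - k - 1), ?_⟩
      simp only [Prod.mk.injEq]; omega

lemma mul_eq_rotate {f g u v u' v' : ℤ → ℝ} {F G U V U' V' : ℝ} (hf : HasSum f F) (hg : HasSum g G)
    (hu : HasSum u U) (hv : HasSum v V) (hu' : HasSum u' U') (hv' : HasSum v' V')
    (h1 : ∀ a b, f (a + b) * g (a - b) = u a * v b)
    (h2 : ∀ a b, f (a + b + 1) * g (a - b) = u' a * v' b) :
    F * G = U * V + U' * V' := by
  have key : ∀ {x y : ℤ → ℝ} {X Y : ℝ}, HasSum x X → HasSum y Y →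
      HasSum (fun p : ℤ × ℤ => x p.1 * y p.2) (X * Y) := fun {x y X Y} hx hy =>
    hx.mul hy (summable_mul_of_summable_norm hx.summable.norm hy.summable.norm)
  have h := tsum_int_prod_eq_rotate (key hf hg).summable
  simp only [h1, h2] at h
  rwa [(key hf hg).tsum_eq, (key hu hv).tsum_eq, (key hu' hv').tsum_eq] at h

lemma thetaThree_sq {t : ℝ} (ht : 0 < t) :
    thetaThree t ^ 2 = thetaThree (2 * t) ^ 2 + thetaTwo (2 * t) ^ 2 := by
  have h2t : 0 < 2 * t := by positivity
  simp only [pow_two]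
  refine mul_eq_rotate (hasSum_thetaThree ht) (hasSum_thetaThree ht) (hasSum_thetaThree h2t)
    (hasSum_thetaThree h2t) (hasSum_thetaTwo h2t) (hasSum_thetaTwo h2t) ?_ ?_ <;>
  · intro a b
    rw [← Real.exp_add, ← Real.exp_add]
    congr 1; push_cast; ring

lemma neg_one_zpow_add_mul_sub (a b : ℤ) : ((-1 : ℝ)) ^ (a + b) * (-1) ^ (a - b) = 1 := by
  rw [← zpow_add₀ (by norm_num), show a + b + (a - b) = 2 * a by ring, zpow_mul]; simp

lemma thetaFour_sq {t : ℝ} (ht : 0 < t) :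
    thetaFour t ^ 2 = thetaThree (2 * t) ^ 2 - thetaTwo (2 * t) ^ 2 := by
  have h2t : 0 < 2 * t := by positivity
  have := mul_eq_rotate (hasSum_thetaFour ht) (hasSum_thetaFour ht) (hasSum_thetaThree h2t)
    (hasSum_thetaThree h2t) (hasSum_thetaTwo h2t) (hasSum_thetaTwo h2t).neg ?_ ?_
  · linear_combination this
  · intro a b
    rw [mul_mul_mul_comm, neg_one_zpow_add_mul_sub, one_mul, ← Real.exp_add, ← Real.exp_add]
    congr 1; push_cast; ring
  · intro a b
    have h : ((-1 : ℝ)) ^ (a + b + 1) * (-1) ^ (a - b) = -1 := by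
      rw [zpow_add_one₀ (by norm_num)]
      linear_combination -neg_one_zpow_add_mul_sub a b
    rw [mul_mul_mul_comm, h, neg_one_mul, ← Real.exp_add, mul_neg, ← Real.exp_add]
    congr 2; push_cast; ring

lemma thetaTwo_sq {t : ℝ} (ht : 0 < t) :
    thetaTwo t ^ 2 = 2 * thetaTwo (2 * t) * thetaThree (2 * t) := by
  have h2t : 0 < 2 * t := by positivity
  have hshift : HasSum (fun n : ℤ => Real.exp (-Real.pi * ((n + 1 : ℤ) : ℝ) ^ 2 * (2 * t)))
      (thetaThree (2 * t)) :=
    (Equiv.addRight (1 : ℤ)).hasSum_iff.mpr (hasSum_thetaThree h2t)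
  have := mul_eq_rotate (hasSum_thetaTwo ht) (hasSum_thetaTwo ht) (hasSum_thetaTwo h2t)
    (hasSum_thetaThree h2t) hshift (hasSum_thetaTwo h2t) ?_ ?_
  · linear_combination this
  all_goals
    intro a b
    rw [← Real.exp_add, ← Real.exp_add]
    congr 1; push_cast; ring

lemma thetaThree_mul_thetaFour {t : ℝ} (ht : 0 < t) :
    thetaThree t * thetaFour t = thetaFour (2 * t) ^ 2 := by
  have h2t : 0 < 2 * t := by positivity
  set k : ℤ → ℝ := fun n => (-1) ^ n * Real.exp (-Real.pi * (n + 1 / 2) ^ 2 * (2 * t)) with hk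
  have hks : Summable k := by
    refine Summable.of_norm_bounded (hasSum_thetaTwo h2t).summable fun n => ?_
    rw [hk, norm_mul, norm_neg_one_zpow, one_mul, Real.norm_of_nonneg (Real.exp_pos _).le]
  have hk0 : ∑' n, k n = 0 := by
    have h := (Equiv.subLeft (-1 : ℤ)).tsum_eq k
    have : ∀ n, k (Equiv.subLeft (-1 : ℤ) n) = -k n := fun n => by
      simp only [hk, Equiv.subLeft_apply]
      rw [zpow_sub₀ (by norm_num), show ((-1 : ℝ)) ^ (-1 : ℤ) = -1 by norm_num,
        show (-1 : ℝ) / (-1) ^ n = -(-1) ^ n by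
          rcases Int.even_or_odd n with h | h <;> simp [h.neg_one_zpow]]
      rw [neg_mul]
      congr 3
      push_cast; ring
    simp_rw [this] at h
    rw [tsum_neg] at h
    linarith
  have := mul_eq_rotate (hasSum_thetaThree ht) (hasSum_thetaFour ht) (hasSum_thetaFour h2t)
    (hasSum_thetaFour h2t) hks.hasSum hks.hasSum ?_ ?_
  · rw [this, hk0]; ring
  all_goals
    intro a b
    have h : ((-1 : ℝ)) ^ (a - b) = (-1) ^ a * (-1) ^ b := by
      rw [zpow_sub₀ (by norm_num)]
      rcases Int.even_or_odd b with h | h <;> simp [h.neg_one_zpow, div_neg]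
  · have he : Real.exp (-Real.pi * ((a + b : ℤ) : ℝ) ^ 2 * t)
        * Real.exp (-Real.pi * ((a - b : ℤ) : ℝ) ^ 2 * t)
        = Real.exp (-Real.pi * a ^ 2 * (2 * t)) * Real.exp (-Real.pi * b ^ 2 * (2 * t)) := by
      rw [← Real.exp_add, ← Real.exp_add]; congr 1; push_cast; ring
    rw [h]
    linear_combination ((-1) ^ a * (-1) ^ b) * he
  · have he : Real.exp (-Real.pi * ((a + b + 1 : ℤ) : ℝ) ^ 2 * t)
        * Real.exp (-Real.pi * ((a - b : ℤ) : ℝ) ^ 2 * t)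
        = Real.exp (-Real.pi * (a + 1 / 2) ^ 2 * (2 * t))
          * Real.exp (-Real.pi * (b + 1 / 2) ^ 2 * (2 * t)) := by
      rw [← Real.exp_add, ← Real.exp_add]; congr 1; push_cast; ring
    simp only [hk]
    rw [h]
    linear_combination ((-1) ^ a * (-1) ^ b) * he

lemma neg_one_zpow_two_mul (n : ℤ) : ((-1 : ℝ)) ^ (2 * n) = 1 := by
  rw [zpow_mul]; simp

lemma neg_one_zpow_two_mul_add_one (n : ℤ) : ((-1 : ℝ)) ^ (2 * n + 1) = -1 := by
  rw [zpow_add_one₀ (by norm_num), neg_one_zpow_two_mul, one_mul]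

lemma thetaThree_add_thetaFour {t : ℝ} (ht : 0 < t) :
    thetaThree t + thetaFour t = 2 * thetaThree (4 * t) := by
  have h3 := tsum_int_eq_even_add_odd (hasSum_thetaThree ht).summable
  have h4 := tsum_int_eq_even_add_odd (hasSum_thetaFour ht).summable
  have e : ∀ n : ℤ, Real.exp (-Real.pi * ((2 * n : ℤ) : ℝ) ^ 2 * t)
      = Real.exp (-Real.pi * n ^ 2 * (4 * t)) := fun n => by congr 1; push_cast; ring
  simp only [e, neg_one_zpow_two_mul, neg_one_zpow_two_mul_add_one, one_mul, neg_one_mul,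
    tsum_neg] at h3 h4
  rw [thetaThree, thetaFour, h3, h4, thetaThree]; ring

lemma thetaThree_sub_thetaFour {t : ℝ} (ht : 0 < t) :
    thetaThree t - thetaFour t = 2 * thetaTwo (4 * t) := by
  have h3 := tsum_int_eq_even_add_odd (hasSum_thetaThree ht).summable
  have h4 := tsum_int_eq_even_add_odd (hasSum_thetaFour ht).summable
  have e : ∀ n : ℤ, Real.exp (-Real.pi * ((2 * n + 1 : ℤ) : ℝ) ^ 2 * t)
      = Real.exp (-Real.pi * (n + 1 / 2) ^ 2 * (4 * t)) := fun n => by congr 1; push_cast; ring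
  simp only [e, neg_one_zpow_two_mul, neg_one_zpow_two_mul_add_one, one_mul, neg_one_mul,
    tsum_neg] at h3 h4
  rw [thetaThree, thetaFour, h3, h4, thetaTwo]; ring

/-- The product `(2i+1)(2j+1)` of two odd numbers, as a real number. -/
def oddMul (p : ℕ × ℕ) : ℝ := (2 * p.1 + 1) * (2 * p.2 + 1)

lemma add_add_one_le_oddMul (p : ℕ × ℕ) : (p.1 : ℝ) + p.2 + 1 ≤ oddMul p := by
  have h1 : (0 : ℝ) ≤ p.1 := by positivity
  have h2 : (0 : ℝ) ≤ p.2 := by positivity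
  unfold oddMul; nlinarith [mul_nonneg h1 h2]

lemma one_le_oddMul (p : ℕ × ℕ) : 1 ≤ oddMul p := by
  have h1 : (0 : ℝ) ≤ p.1 := by positivity
  have h2 : (0 : ℝ) ≤ p.2 := by positivity
  linarith [add_add_one_le_oddMul p]

lemma oddMul_pos (p : ℕ × ℕ) : 0 < oddMul p := one_pos.trans_le (one_le_oddMul p)

lemma summable_exp_neg_mul_oddMul {a : ℝ} (ha : 0 < a) :
    Summable fun p : ℕ × ℕ => Real.exp (-a * oddMul p) := by
  have hg : Summable fun n : ℕ => Real.exp (-a) ^ n :=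
    summable_geometric_of_lt_one (Real.exp_pos _).le (by simpa using ha)
  refine Summable.of_nonneg_of_le (fun _ => (Real.exp_pos _).le) (fun p => ?_)
    (hg.mul_of_nonneg hg (fun _ => by positivity) fun _ => by positivity)
  rw [← pow_add, ← Real.exp_nat_mul]
  refine Real.exp_le_exp.mpr ?_
  push_cast
  nlinarith [add_add_one_le_oddMul p]

lemma summable_oddMul_mul_exp {a : ℝ} (ha : 0 < a) :
    Summable fun p : ℕ × ℕ => oddMul p * Real.exp (-a * oddMul p) := by
  refine Summable.of_nonneg_of_le (fun p => mul_nonneg (oddMul_pos p).le (Real.exp_pos _).le)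
    (fun p => ?_) ((summable_exp_neg_mul_oddMul (half_pos ha)).mul_left (2 / a))
  have h1 := Real.add_one_le_exp (a / 2 * oddMul p)
  have h2 : Real.exp (-a * oddMul p)
      = Real.exp (-(a / 2) * oddMul p) * Real.exp (-(a / 2) * oddMul p) := by
    rw [← Real.exp_add]; congr 1; ring
  have h3 : Real.exp (a / 2 * oddMul p) * Real.exp (-(a / 2) * oddMul p) = 1 := by
    rw [← Real.exp_add]; simp
  have h4 := Real.exp_pos (-(a / 2) * oddMul p)
  have h5 : oddMul p * Real.exp (-(a / 2) * oddMul p) ≤ 2 / a := by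
    rw [le_div_iff₀ ha]
    nlinarith [oddMul_pos p]
  rw [h2, ← mul_assoc]
  exact mul_le_mul_of_nonneg_right h5 h4.le

lemma two_mul_add_one_le_oddMul (p : ℕ × ℕ) : (2 * p.1 + 1 : ℝ) ≤ oddMul p := by
  have h1 : (0 : ℝ) ≤ p.1 := by positivity
  have h2 : (0 : ℝ) ≤ p.2 := by positivity
  unfold oddMul; nlinarith [mul_nonneg h1 h2]

/-- The Lambert series `∑ q^{mn} / n` over odd `m, n`, at `q = exp(-πt)`. -/
noncomputable def oddLog (t : ℝ) : ℝ :=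
  ∑' p : ℕ × ℕ, Real.exp (-(Real.pi * t) * oddMul p) / (2 * p.2 + 1)

/-- The Lambert series `∑ m q^{mn}` over odd `m, n`, at `q = exp(-πt)`. -/
noncomputable def oddSigma (t : ℝ) : ℝ :=
  ∑' p : ℕ × ℕ, (2 * p.1 + 1) * Real.exp (-(Real.pi * t) * oddMul p)

lemma hasSum_oddLog {t : ℝ} (ht : 0 < t) :
    HasSum (fun p : ℕ × ℕ => Real.exp (-(Real.pi * t) * oddMul p) / (2 * p.2 + 1)) (oddLog t) := by
  refine (Summable.of_nonneg_of_le (fun p => by positivity) (fun p => ?_)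
    (summable_exp_neg_mul_oddMul (mul_pos Real.pi_pos ht))).hasSum
  exact div_le_self (Real.exp_pos _).le (by linarith [show (0 : ℝ) ≤ p.2 by positivity])

lemma hasSum_oddSigma {t : ℝ} (ht : 0 < t) :
    HasSum (fun p : ℕ × ℕ => (2 * p.1 + 1) * Real.exp (-(Real.pi * t) * oddMul p))
      (oddSigma t) := by
  refine (Summable.of_nonneg_of_le (fun p => by positivity) (fun p => ?_)
    (summable_oddMul_mul_exp (mul_pos Real.pi_pos ht))).hasSum
  exact mul_le_mul_of_nonneg_right (two_mul_add_one_le_oddMul p) (Real.exp_pos _).le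

lemma oddLog_pos {t : ℝ} (ht : 0 < t) : 0 < oddLog t :=
  (hasSum_oddLog ht).summable.tsum_pos (fun _ => by positivity) (0, 0) (by positivity)

lemma oddSigma_pos {t : ℝ} (ht : 0 < t) : 0 < oddSigma t :=
  (hasSum_oddSigma ht).summable.tsum_pos (fun _ => by positivity) (0, 0) (by positivity)

lemma hasDerivAt_oddLog {t : ℝ} (ht : 0 < t) :
    HasDerivAt oddLog (-Real.pi * oddSigma t) t := by
  have hd : ∀ (p : ℕ × ℕ) (s : ℝ), HasDerivAt
      (fun s => Real.exp (-(Real.pi * s) * oddMul p) / (2 * p.2 + 1))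
      (-Real.pi * ((2 * p.1 + 1) * Real.exp (-(Real.pi * s) * oddMul p))) s := fun p s => by
    have h := ((((hasDerivAt_id s).const_mul Real.pi).neg.mul_const (oddMul p)).exp).div_const
      (2 * p.2 + 1 : ℝ)
    refine h.congr_deriv ?_
    have : (2 * p.2 + 1 : ℝ) ≠ 0 := by positivity
    simp only [id, mul_one, oddMul, Pi.neg_apply]
    field_simp
  have := hasDerivAt_tsum_of_isPreconnected
    (u := fun p => Real.pi * (oddMul p * Real.exp (-(Real.pi * (t / 2)) * oddMul p)))
    ((summable_oddMul_mul_exp (by positivity)).mul_left _) isOpen_Ioi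
    (isPreconnected_Ioi (a := t / 2)) (fun p s _ => hd p s) (fun p s hs => ?_)
    (show t ∈ Ioi (t / 2) by simp; linarith) (hasSum_oddLog ht).summable
    (show t ∈ Ioi (t / 2) by simp; linarith)
  · rw [tsum_mul_left] at this
    exact this
  · rw [norm_mul, norm_neg, Real.norm_of_nonneg Real.pi_pos.le,
      Real.norm_of_nonneg (by positivity)]
    have h1 : Real.exp (-(Real.pi * s) * oddMul p) ≤ Real.exp (-(Real.pi * (t / 2)) * oddMul p) := by
      refine Real.exp_le_exp.mpr ?_
      have := mul_pos Real.pi_pos (oddMul_pos p)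
      have hs' : t / 2 < s := hs
      nlinarith
    have h2 := two_mul_add_one_le_oddMul p
    have h3 := oddMul_pos p
    gcongr

lemma thetaThree_eq_tsum_pow (t : ℝ) :
    thetaThree t = ∑' n : ℤ, (1 : ℝ) ^ n * Real.exp (-Real.pi * t) ^ (n.natAbs ^ 2) := by
  refine tsum_congr fun n => ?_
  rw [one_zpow, one_mul, ← Real.exp_nat_mul]
  congr 1
  push_cast
  rw [Nat.cast_natAbs, Int.cast_abs, sq_abs]; ring

lemma thetaFour_eq_tsum_pow (t : ℝ) :
    thetaFour t = ∑' n : ℤ, (-1 : ℝ) ^ n * Real.exp (-Real.pi * t) ^ (n.natAbs ^ 2) := by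
  refine tsum_congr fun n => ?_
  rw [← Real.exp_nat_mul]
  congr 2
  push_cast
  rw [Nat.cast_natAbs, Int.cast_abs, sq_abs]; ring

lemma exp_neg_pi_mul_lt_one {t : ℝ} (ht : 0 < t) : Real.exp (-Real.pi * t) < 1 := by
  rw [Real.exp_lt_one_iff]; nlinarith [Real.pi_pos]

lemma hasSum_log_div_oddLog {t : ℝ} (ht : 0 < t) :
    HasSum (fun i : ℕ => (Real.log (1 + Real.exp (-Real.pi * t) ^ (2 * i + 1))
      - Real.log (1 - Real.exp (-Real.pi * t) ^ (2 * i + 1))) / 2) (oddLog t) := by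
  refine (hasSum_oddLog ht).prod_fiberwise fun i => ?_
  have hq : |Real.exp (-Real.pi * t) ^ (2 * i + 1)| < 1 := by
    rw [abs_of_pos (by positivity)]
    exact pow_lt_one₀ (Real.exp_pos _).le (exp_neg_pi_mul_lt_one ht) (by omega)
  refine ((Real.hasSum_log_sub_log_of_abs_lt_one hq).div_const 2).congr_fun fun j => ?_
  rw [← pow_mul, ← Real.exp_nat_mul, oddMul]
  push_cast
  rw [show -(Real.pi * t) * ((2 * (i : ℝ) + 1) * (2 * j + 1))
    = (2 * i + 1) * (2 * j + 1) * (-Real.pi * t) by ring]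
  ring

lemma thetaFour_div_thetaThree {t : ℝ} (ht : 0 < t) :
    thetaFour t / thetaThree t = Real.exp (-4 * oddLog t) := by
  set q := Real.exp (-Real.pi * t) with hq
  have h0 : 0 < q := Real.exp_pos _
  have h1 : q < 1 := exp_neg_pi_mul_lt_one ht
  have hE := eulerProduct_pos (Q := q ^ 2) (by positivity) (pow_lt_one₀ h0.le h1 (by norm_num))
  have h3 := tendsto_triple_product h0 h1 one_ne_zero
  have h4 := tendsto_triple_product h0 h1 (neg_ne_zero.mpr one_ne_zero)
  rw [← thetaThree_eq_tsum_pow] at h3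
  rw [← thetaFour_eq_tsum_pow] at h4
  have hlim := h4.div h3 (div_pos (thetaThree_pos ht) hE).ne'
  rw [div_div_div_cancel_right₀ hE.ne'] at hlim
  have hlog := (hasSum_log_div_oddLog ht).tendsto_sum_nat
  refine tendsto_nhds_unique hlim ?_
  refine ((Real.continuous_exp.tendsto _).comp (hlog.const_mul (-4))).congr fun N => ?_
  simp only [Function.comp_apply, Pi.div_apply]
  rw [Finset.mul_sum, Real.exp_sum, ← Finset.prod_div_distrib]
  refine Finset.prod_congr rfl fun i _ => ?_
  have hp : 0 < q ^ (2 * i + 1) := by positivity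
  have hp1 : q ^ (2 * i + 1) < 1 := pow_lt_one₀ h0.le h1 (by omega)
  rw [← hq, show -4 * ((Real.log (1 + q ^ (2 * i + 1)) - Real.log (1 - q ^ (2 * i + 1))) / 2)
    = Real.log (((1 - q ^ (2 * i + 1)) / (1 + q ^ (2 * i + 1))) ^ 2) by
      rw [Real.log_pow, Real.log_div (by linarith) (by linarith)]; push_cast; ring,
    Real.exp_log (by have : 0 < 1 - q ^ (2 * i + 1) := by linarith
                     positivity)]
  norm_num
  rw [div_pow, ← sub_eq_add_neg]
  ring_nf

/-- The ratio `θ₄(it)/θ₃(it)`. -/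
noncomputable def thetaRatio (t : ℝ) : ℝ := thetaFour t / thetaThree t

lemma thetaRatio_pos {t : ℝ} (ht : 0 < t) : 0 < thetaRatio t :=
  div_pos (thetaFour_pos ht) (thetaThree_pos ht)

lemma thetaRatio_lt_one {t : ℝ} (ht : 0 < t) : thetaRatio t < 1 := by
  rw [thetaRatio, thetaFour_div_thetaThree ht, Real.exp_lt_one_iff]
  linarith [oddLog_pos ht]

lemma hasDerivAt_thetaRatio {t : ℝ} (ht : 0 < t) :
    HasDerivAt thetaRatio (4 * Real.pi * oddSigma t * thetaRatio t) t := by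
  have h := ((hasDerivAt_oddLog ht).const_mul (-4)).exp
  rw [← thetaFour_div_thetaThree ht] at h
  refine (h.congr_of_eventuallyEq ?_).congr_deriv (by rw [thetaRatio]; ring)
  filter_upwards [Ioi_mem_nhds ht] with s hs
  exact thetaFour_div_thetaThree hs

lemma thetaRatio_two_mul_sq {t : ℝ} (ht : 0 < t) :
    thetaRatio (2 * t) ^ 2 * (1 + thetaRatio t ^ 2) = 2 * thetaRatio t := by
  have h3 := thetaThree_pos ht
  have h3' := thetaThree_pos (show 0 < 2 * t by positivity)
  have e1 := thetaThree_sq ht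
  have e2 := thetaFour_sq ht
  have e3 := thetaThree_mul_thetaFour ht
  unfold thetaRatio
  rw [div_pow, div_pow, ← e3]
  field_simp
  linear_combination (thetaFour t) * (e1 + e2)

lemma oddSigma_two_mul {t : ℝ} (ht : 0 < t) :
    4 * oddSigma (2 * t) * (1 + thetaRatio t ^ 2) = oddSigma t * (1 - thetaRatio t ^ 2) := by
  have h2t : 0 < 2 * t := by positivity
  have hy := hasDerivAt_thetaRatio ht
  have hy2 : HasDerivAt (fun s => thetaRatio (2 * s))
      (4 * Real.pi * oddSigma (2 * t) * thetaRatio (2 * t) * 2) t := by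
    have := (hasDerivAt_thetaRatio h2t).comp t ((hasDerivAt_id t).const_mul 2)
    simpa [Function.comp_def] using this
  have hl := (hy2.pow 2).mul ((hy.pow 2).const_add 1)
  have hr := hy.const_mul 2
  have hE : (fun s => thetaRatio (2 * s)) ^ 2 * (fun s => 1 + (thetaRatio ^ 2) s)
      =ᶠ[𝓝 t] fun s => 2 * thetaRatio s := by
    filter_upwards [Ioi_mem_nhds ht] with s hs
    exact thetaRatio_two_mul_sq hs
  have key := hl.unique (hr.congr_of_eventuallyEq hE)
  have e := thetaRatio_two_mul_sq ht
  have hp := thetaRatio_pos ht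
  simp only [Pi.pow_apply] at key
  norm_num at key
  set y := thetaRatio t
  set z := thetaRatio (2 * t)
  set w := oddSigma (2 * t)
  set v := oddSigma t
  have hpi := Real.pi_pos
  have key2 : y * (4 * w * (1 + y ^ 2)) = y * (v * (1 - y ^ 2)) := by
    refine mul_left_cancel₀ (show Real.pi ≠ 0 from hpi.ne') ?_
    linear_combination (1 + y ^ 2) / 8 * key - (2 * Real.pi * w * (1 + y ^ 2) + Real.pi * v * y ^ 2) * e
  exact mul_left_cancel₀ hp.ne' key2

lemma thetaTwo_pow_four_two_mul {t : ℝ} (ht : 0 < t) :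
    4 * thetaTwo (2 * t) ^ 4 * (1 + thetaRatio t ^ 2)
      = thetaTwo t ^ 4 * (1 - thetaRatio t ^ 2) := by
  have h3 := thetaThree_pos ht
  have e1 := thetaThree_sq ht
  have e2 := thetaFour_sq ht
  have e3 := thetaTwo_sq ht
  have e4 : thetaTwo t ^ 4 = 4 * thetaTwo (2 * t) ^ 2 * thetaThree (2 * t) ^ 2 := by
    rw [show thetaTwo t ^ 4 = (thetaTwo t ^ 2) ^ 2 by ring, e3]; ring
  unfold thetaRatio
  rw [e4]
  field_simp
  rw [e2, e1]; ring

lemma tendsto_oddSigma_mul_exp :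
    Tendsto (fun t => oddSigma t * Real.exp (Real.pi * t)) atTop (𝓝 1) := by
  have h := tendsto_tsum_of_dominated_convergence (𝓕 := atTop)
    (f := fun (t : ℝ) (p : ℕ × ℕ) => (2 * p.1 + 1) * Real.exp (-(Real.pi * t) * (oddMul p - 1)))
    (g := fun p => if p = (0, 0) then 1 else 0)
    (bound := fun p => oddMul p * Real.exp (-(Real.pi * 1) * oddMul p) * Real.exp (Real.pi * 1))
    ((summable_oddMul_mul_exp (by positivity)).mul_right _) (fun p => ?_) ?_
  · rw [tsum_ite_eq] at h
    refine h.congr fun t => ?_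
    rw [oddSigma, ← tsum_mul_right]
    refine tsum_congr fun p => ?_
    rw [mul_assoc, ← Real.exp_add]; congr 2; ring
  · split_ifs with hp
    · subst hp; simp [oddMul]
    · have h1 : 1 < oddMul p := by
        have h2 : (1 : ℝ) ≤ p.1 + p.2 := by
          have : 1 ≤ p.1 + p.2 := by
            by_contra hlt
            exact hp (Prod.ext (by omega) (by omega))
          exact_mod_cast this
        linarith [add_add_one_le_oddMul p]
      have : Tendsto (fun t : ℝ => Real.exp (-(Real.pi * t) * (oddMul p - 1))) atTop (𝓝 0) := by
        refine Real.tendsto_exp_atBot.comp ?_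
        have : Tendsto (fun t : ℝ => (Real.pi * (oddMul p - 1)) * t) atTop atTop :=
          tendsto_id.const_mul_atTop (mul_pos Real.pi_pos (by linarith))
        refine (tendsto_neg_atTop_atBot.comp this).congr fun t => ?_
        simp only [Function.comp_apply]; ring
      simpa using this.const_mul (2 * p.1 + 1 : ℝ)
  · filter_upwards [eventually_ge_atTop 1] with t ht p
    rw [Real.norm_of_nonneg (by positivity), mul_assoc (oddMul p), ← Real.exp_add]
    have h2 := oddMul_pos p
    refine mul_le_mul (two_mul_add_one_le_oddMul p) (Real.exp_le_exp.mpr ?_)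
      (Real.exp_pos _).le h2.le
    nlinarith [mul_nonneg (sub_nonneg.mpr ht) (sub_nonneg.mpr (one_le_oddMul p)), Real.pi_pos,
      mul_nonneg Real.pi_pos.le (mul_nonneg (sub_nonneg.mpr ht) (sub_nonneg.mpr (one_le_oddMul p)))]

lemma tendsto_thetaTwo_mul_exp :
    Tendsto (fun t => thetaTwo t * Real.exp (Real.pi * t / 4)) atTop (𝓝 2) := by
  have hnn : ∀ n : ℤ, (0 : ℝ) ≤ n ^ 2 + n := fun n => by
    have : 0 ≤ n ^ 2 + n := by
      rcases le_or_gt 0 n with h | h <;> nlinarith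
    exact_mod_cast this
  have h := tendsto_tsum_of_dominated_convergence (𝓕 := atTop)
    (f := fun (t : ℝ) (n : ℤ) => Real.exp (-(Real.pi * t) * (n ^ 2 + n)))
    (g := fun n => if n = 0 ∨ n = -1 then 1 else 0)
    (bound := fun n => Real.exp (-Real.pi * (n + 1 / 2) ^ 2 * 1) * Real.exp (Real.pi / 4))
    ((hasSum_thetaTwo one_pos).summable.mul_right _) (fun n => ?_) ?_
  · have hs : ∑' n : ℤ, (if n = 0 ∨ n = -1 then (1 : ℝ) else 0) = 2 := by
      rw [tsum_eq_sum (s := {0, -1}) (fun n hn => by simp at hn; simp [hn]),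
        Finset.sum_pair (by norm_num)]
      norm_num
    rw [hs] at h
    refine h.congr fun t => ?_
    rw [thetaTwo, ← tsum_mul_right]
    refine tsum_congr fun p => ?_
    rw [← Real.exp_add]; congr 1; ring
  · split_ifs with hp
    · rcases hp with rfl | rfl <;> simp
    · have h1 : (0 : ℝ) < n ^ 2 + n := by
        refine lt_of_le_of_ne (hnn n) fun h0 => hp ?_
        have : n * (n + 1) = 0 := by
          have : n ^ 2 + n = 0 := by exact_mod_cast h0.symm
          linarith
        rcases mul_eq_zero.mp this with h | h
        · exact Or.inl h
        · exact Or.inr (by omega)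
      refine Real.tendsto_exp_atBot.comp ?_
      have : Tendsto (fun t : ℝ => (Real.pi * (n ^ 2 + n)) * t) atTop atTop :=
        tendsto_id.const_mul_atTop (mul_pos Real.pi_pos h1)
      refine (tendsto_neg_atTop_atBot.comp this).congr fun t => ?_
      simp only [Function.comp_apply]; ring
  · filter_upwards [eventually_ge_atTop 1] with t ht n
    rw [Real.norm_of_nonneg (by positivity), ← Real.exp_add]
    refine Real.exp_le_exp.mpr ?_
    nlinarith [mul_nonneg Real.pi_pos.le (mul_nonneg (sub_nonneg.mpr ht) (hnn n))]

lemma oddSigma_eq {t : ℝ} (ht : 0 < t) : oddSigma t = thetaTwo t ^ 4 / 16 := by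
  set R : ℝ → ℝ := fun t => oddSigma t / thetaTwo t ^ 4 with hR
  have hstep : ∀ s, 0 < s → R (2 * s) = R s := fun s hs => by
    have h1 := oddSigma_two_mul hs
    have h2 := thetaTwo_pow_four_two_mul hs
    have hy0 := thetaRatio_pos hs
    have hy1 := thetaRatio_lt_one hs
    have hpos := thetaTwo_pos hs
    have hpos2 := thetaTwo_pos (show 0 < 2 * s by positivity)
    have hm : 0 < 1 - thetaRatio s ^ 2 := by nlinarith
    simp only [hR]
    rw [div_eq_div_iff (by positivity) (by positivity)]
    refine mul_right_cancel₀ hm.ne' ?_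
    refine mul_right_cancel₀ (show (1 + thetaRatio s ^ 2) ≠ 0 by positivity) ?_
    linear_combination -(oddSigma (2 * s)) * (1 + thetaRatio s ^ 2) * h2
      + thetaTwo (2 * s) ^ 4 * (1 + thetaRatio s ^ 2) * h1
  have hlim : Tendsto R atTop (𝓝 (1 / 2 ^ 4)) := by
    refine (tendsto_oddSigma_mul_exp.div (tendsto_thetaTwo_mul_exp.pow 4) (by norm_num)).congr
      fun s => ?_
    have : Real.exp (Real.pi * s / 4) ^ 4 = Real.exp (Real.pi * s) := by
      rw [← Real.exp_nat_mul]; congr 1; push_cast; ring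
    simp only [Pi.div_apply]
    rw [mul_pow, this, mul_div_mul_right _ _ (Real.exp_pos _).ne']
  have hiter : ∀ n : ℕ, R (2 ^ n * t) = R t := fun n => by
    induction n with
    | zero => simp
    | succ n ih => rw [pow_succ', mul_assoc, hstep _ (by positivity), ih]
  have hseq : Tendsto (fun n : ℕ => (2 : ℝ) ^ n * t) atTop atTop :=
    (tendsto_pow_atTop_atTop_of_one_lt one_lt_two).atTop_mul_const ht
  have h := tendsto_nhds_unique ((hlim.comp hseq).congr hiter) tendsto_const_nhds
  have hpos := thetaTwo_pos ht
  rw [hR] at h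
  simp only at h
  field_simp at h ⊢
  linarith

lemma HasSum.congr_fun_eq {ι : Type*} {f g : ι → ℝ} {a b : ℝ} (hf : HasSum f a)
    (hfg : ∀ n, g n = f n) (hab : b = a) : HasSum g b :=
  hab ▸ hf.congr_fun hfg

/-- The Lambert series `∑ χ₄(m) q^{mn}` over odd `m, n`, at `q = exp(-πt)`. -/
noncomputable def oddChi (t : ℝ) : ℝ :=
  ∑' p : ℕ × ℕ, (-1) ^ p.1 * Real.exp (-(Real.pi * t) * oddMul p)

lemma summable_norm_oddChi {t : ℝ} (ht : 0 < t) :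
    Summable fun p : ℕ × ℕ => ‖(-1) ^ p.1 * Real.exp (-(Real.pi * t) * oddMul p)‖ := by
  refine (summable_exp_neg_mul_oddMul (mul_pos Real.pi_pos ht)).congr fun p => ?_
  rw [norm_mul, norm_pow, norm_neg, norm_one, one_pow, one_mul,
    Real.norm_of_nonneg (Real.exp_pos _).le]

lemma hasSum_oddChi {t : ℝ} (ht : 0 < t) :
    HasSum (fun p : ℕ × ℕ => (-1) ^ p.1 * Real.exp (-(Real.pi * t) * oddMul p)) (oddChi t) :=
  (summable_norm_oddChi ht).of_norm.hasSum

lemma hasSum_neg_one_pow_mul_exp {u : ℝ} (hu : 0 < u) :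
    HasSum (fun i : ℕ => (-1) ^ i * Real.exp (-u * (2 * i + 1))) ((Real.cosh u)⁻¹ / 2) := by
  have hx : |-(Real.exp (-u) ^ 2)| < 1 := by
    rw [abs_neg, abs_of_pos (by positivity)]
    exact pow_lt_one₀ (Real.exp_pos _).le (by simpa using hu) (by norm_num)
  have h := (hasSum_geometric_of_abs_lt_one hx).mul_left (Real.exp (-u))
  have h2 : Real.exp u * Real.exp (-u) = 1 := by rw [← Real.exp_add]; simp
  have hp := Real.exp_pos (-u)
  have hp' := Real.exp_pos u
  refine HasSum.congr_fun_eq h (fun i => ?_) ?_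
  · rw [neg_eq_neg_one_mul (Real.exp (-u) ^ 2), mul_pow, ← pow_mul, mul_left_comm, ← pow_succ',
      ← Real.exp_nat_mul]
    congr 2; push_cast; ring
  · rw [Real.cosh_eq]
    have h6 : 1 - -(Real.exp (-u) ^ 2) = Real.exp (-u) * (Real.exp u + Real.exp (-u)) := by
      linear_combination -h2
    rw [h6]
    field_simp

lemma hasSum_inv_cosh_nat {t : ℝ} (ht : 0 < t) :
    HasSum (fun j : ℕ => (Real.cosh ((2 * j + 1) * (Real.pi * t)))⁻¹) (2 * oddChi t) := by
  have h := ((Equiv.prodComm ℕ ℕ).hasSum_iff.mpr (hasSum_oddChi ht)).prod_fiberwise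
    (g := fun j : ℕ => (Real.cosh ((2 * j + 1) * (Real.pi * t)))⁻¹ / 2) fun j => ?_
  · refine (h.mul_left 2).congr_fun fun j => ?_
    ring
  · refine (hasSum_neg_one_pow_mul_exp (u := (2 * j + 1) * (Real.pi * t)) ?_).congr_fun fun i => ?_
    · have := Real.pi_pos; positivity
    · simp only [Function.comp_apply, Equiv.prodComm_apply, Prod.swap_prod_mk, oddMul]
      congr 2; ring

lemma hasSum_int_of_hasSum_nat {f : ℤ → ℝ} (hf : ∀ n, f (-(n + 1)) = f n) {a : ℝ}
    (h : HasSum (fun n : ℕ => f n) a) : HasSum f (2 * a) := by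
  rw [two_mul]
  exact HasSum.of_nat_of_neg_add_one h (h.congr_fun fun n => hf n)

lemma cosh_odd_neg (h : ℝ) (n : ℤ) :
    Real.cosh ((2 * ((-(n + 1) : ℤ) : ℝ) + 1) * h) = Real.cosh ((2 * n + 1) * h) := by
  rw [← Real.cosh_neg]; congr 1; push_cast; ring

lemma hasSum_inv_cosh {t : ℝ} (ht : 0 < t) :
    HasSum (fun n : ℤ => (Real.cosh ((2 * n + 1) * (Real.pi * t)))⁻¹) (4 * oddChi t) := by
  have := hasSum_int_of_hasSum_nat (f := fun n : ℤ => (Real.cosh ((2 * n + 1) * (Real.pi * t)))⁻¹)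
    (fun n => by simp only [cosh_odd_neg]) (hasSum_inv_cosh_nat ht)
  convert this using 1; ring

lemma tendsto_tanh_atTop : Tendsto Real.tanh atTop (𝓝 1) := by
  have h1 : Tendsto (fun x : ℝ => Real.exp (-(2 * x))) atTop (𝓝 0) :=
    Real.tendsto_exp_neg_atTop_nhds_zero.comp (tendsto_id.const_mul_atTop two_pos)
  have h2 : Tendsto (fun x : ℝ => (1 - Real.exp (-(2 * x))) / (1 + Real.exp (-(2 * x)))) atTop
      (𝓝 ((1 - 0) / (1 + 0))) := (h1.const_sub 1).div (h1.const_add 1) (by norm_num)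
  norm_num at h2
  refine h2.congr fun x => ?_
  have e1 : Real.exp (-(2 * x)) = Real.exp (-x) * Real.exp (-x) := by
    rw [← Real.exp_add]; congr 1; ring
  have e2 : Real.exp x * Real.exp (-x) = 1 := by rw [← Real.exp_add]; simp
  have hp := Real.exp_pos x
  have hn := Real.exp_pos (-x)
  rw [Real.tanh_eq_sinh_div_cosh, Real.sinh_eq, Real.cosh_eq, e1]
  field_simp
  linear_combination (-2 * Real.exp (-x)) * e2

lemma monotone_tanh : Monotone Real.tanh := by
  intro a b hab
  rw [Real.tanh_eq_sinh_div_cosh, Real.tanh_eq_sinh_div_cosh,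
    div_le_div_iff₀ (Real.cosh_pos _) (Real.cosh_pos _)]
  have h : 0 ≤ Real.sinh (b - a) := Real.sinh_nonneg_iff.mpr (by linarith)
  rw [Real.sinh_sub] at h
  linarith

lemma hasSum_tanh_add_one_sub {h : ℝ} (hh : 0 < h) :
    HasSum (fun n : ℤ => Real.tanh ((2 * ((n + 1 : ℤ) : ℝ) + 1) * h)
      - Real.tanh ((2 * n + 1) * h)) 2 := by
  have hnn : ∀ x : ℝ, 0 ≤ Real.tanh ((2 * (x + 1) + 1) * h) - Real.tanh ((2 * x + 1) * h) :=
    fun x => sub_nonneg.mpr (monotone_tanh (by nlinarith))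
  have hat : ∀ c : ℝ, Tendsto (fun N : ℕ => Real.tanh ((2 * N + c) * h)) atTop (𝓝 1) := fun c => by
    refine tendsto_tanh_atTop.comp ?_
    refine Tendsto.atTop_mul_const hh ?_
    exact tendsto_atTop_add_const_right _ _
      (tendsto_natCast_atTop_atTop.const_mul_atTop two_pos)
  have h1 : HasSum (fun n : ℕ => Real.tanh ((2 * (((n : ℤ) + 1 : ℤ) : ℝ) + 1) * h)
      - Real.tanh ((2 * ((n : ℤ) : ℝ) + 1) * h)) (1 - Real.tanh h) := by
    rw [hasSum_iff_tendsto_nat_of_nonneg (fun n => by push_cast; exact hnn n)]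
    refine ((hat 1).sub_const (Real.tanh h)).congr fun N => ?_
    have := Finset.sum_range_sub (fun n : ℕ => Real.tanh ((2 * n + 1) * h)) N
    simp only [Nat.cast_zero, mul_zero, zero_add, one_mul] at this
    rw [← this]
    refine Finset.sum_congr rfl fun n _ => ?_
    push_cast; ring
  have h2 : HasSum (fun n : ℕ => Real.tanh ((2 * ((-((n : ℤ) + 1) + 1 : ℤ) : ℝ) + 1) * h)
      - Real.tanh ((2 * ((-((n : ℤ) + 1) : ℤ) : ℝ) + 1) * h)) (1 + Real.tanh h) := by
    rw [hasSum_iff_tendsto_nat_of_nonneg (fun n => by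
      have := hnn (-(n + 1)); push_cast; exact this)]
    refine ((hat (-1)).add_const (Real.tanh h)).congr fun N => ?_
    have := Finset.sum_range_sub (fun n : ℕ => Real.tanh ((2 * n + -1) * h)) N
    simp only [Nat.cast_zero, mul_zero, zero_add, neg_one_mul, Real.tanh_neg, sub_neg_eq_add]
      at this
    rw [← this]
    refine Finset.sum_congr rfl fun n _ => ?_
    rw [← neg_sub_neg, ← Real.tanh_neg, ← Real.tanh_neg]
    congr 2 <;> · push_cast; ring
  have := HasSum.of_nat_of_neg_add_one (f := fun n : ℤ =>
    Real.tanh ((2 * ((n + 1 : ℤ) : ℝ) + 1) * h) - Real.tanh ((2 * n + 1) * h)) h1 h2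
  convert this using 1; ring

lemma hasSum_add_int_sub {f : ℤ → ℝ} {a : ℝ} (hf : HasSum (fun n => f (n + 1) - f n) a) (k : ℤ) :
    HasSum (fun n => f (n + k) - f n) (k * a) := by
  have hshift : ∀ m : ℤ, HasSum (fun n => f (n + m + 1) - f (n + m)) a := fun m =>
    (Equiv.addRight m).hasSum_iff.mpr hf
  induction k using Int.induction_on with
  | zero => simp [hasSum_zero]
  | succ k ih =>
    refine HasSum.congr_fun_eq (ih.add (hshift k)) (fun n => ?_) ?_
    · rw [add_assoc n]; ring
    · push_cast; ring
  | pred k ih =>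
    refine HasSum.congr_fun_eq (ih.sub (hshift (-k - 1))) (fun n => ?_) ?_
    · rw [show n + (-(k : ℤ) - 1) + 1 = n + -k by ring]; ring
    · push_cast; ring

lemma inv_cosh_mul_inv_cosh {a b : ℝ} (h : a ≠ b) :
    (Real.cosh a)⁻¹ * (Real.cosh b)⁻¹ = (Real.tanh b - Real.tanh a) / Real.sinh (b - a) := by
  have h1 := (Real.cosh_pos a).ne'
  have h2 := (Real.cosh_pos b).ne'
  have h3 : Real.sinh (b - a) ≠ 0 := by
    rw [Ne, Real.sinh_eq_zero]; exact sub_ne_zero.mpr h.symm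
  rw [Real.tanh_eq_sinh_div_cosh, Real.tanh_eq_sinh_div_cosh]
  rw [eq_div_iff h3, Real.sinh_sub]
  field_simp

lemma hasSum_inv_cosh_mul_shift {h : ℝ} (hh : 0 < h) {k : ℤ} (hk : k ≠ 0) :
    HasSum (fun n : ℤ => (Real.cosh ((2 * n + 1) * h))⁻¹
      * (Real.cosh ((2 * ((n + k : ℤ) : ℝ) + 1) * h))⁻¹) (2 * k / Real.sinh (2 * k * h)) := by
  have h1 := (hasSum_add_int_sub (f := fun n : ℤ => Real.tanh ((2 * n + 1) * h))
    (hasSum_tanh_add_one_sub hh) k).div_const (Real.sinh (2 * k * h))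
  rw [mul_comm (k : ℝ) 2] at h1
  refine h1.congr_fun fun n => ?_
  rw [inv_cosh_mul_inv_cosh]
  · congr 2; push_cast; ring
  · intro he
    have := mul_right_cancel₀ hh.ne' he
    push_cast at this
    have : (k : ℝ) = 0 := by linarith
    exact hk (by exact_mod_cast this)

lemma hasSum_exp_odd {u : ℝ} (hu : 0 < u) :
    HasSum (fun n : ℕ => Real.exp (-u * (2 * n + 1))) ((Real.sinh u)⁻¹ / 2) := by
  have hx : |Real.exp (-u) ^ 2| < 1 := by
    rw [abs_of_pos (by positivity)]
    exact pow_lt_one₀ (Real.exp_pos _).le (by simpa using hu) (by norm_num)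
  have h := (hasSum_geometric_of_abs_lt_one hx).mul_left (Real.exp (-u))
  have h2 : Real.exp u * Real.exp (-u) = 1 := by rw [← Real.exp_add]; simp
  have hp := Real.exp_pos (-u)
  have h3 : Real.exp (-u) < 1 := by simpa using hu
  have h4 : 1 < Real.exp u := by simpa using hu
  refine HasSum.congr_fun_eq h (fun i => ?_) ?_
  · rw [← pow_mul, ← pow_succ', ← Real.exp_nat_mul]
    congr 1; push_cast; ring
  · rw [Real.sinh_eq]
    have h5 : Real.exp u - Real.exp (-u) ≠ 0 := by linarith
    have h6 : 1 - Real.exp (-u) ^ 2 ≠ 0 := by nlinarith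
    field_simp
    linear_combination -h2

lemma hasSum_sq_inv_cosh {u : ℝ} (hu : 0 < u) :
    HasSum (fun j : ℕ => (-1) ^ j * (j + 1) * Real.exp (-(2 * u) * (j + 1)))
      ((Real.cosh u)⁻¹ ^ 2 / 4) := by
  set x := Real.exp (-u) ^ 2 with hxdef
  have hx0 : 0 < x := by positivity
  have hx : ‖-x‖ < 1 := by
    rw [norm_neg, Real.norm_of_nonneg hx0.le]
    exact pow_lt_one₀ (Real.exp_pos _).le (by simpa using hu) (by norm_num)
  have h0 := hasSum_coe_mul_geometric_of_norm_lt_one hx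
  have h1 : HasSum (fun n : ℕ => ((n + 1 : ℕ) : ℝ) * (-x) ^ (n + 1)) (-x / (1 - -x) ^ 2) := by
    have := (hasSum_nat_add_iff' (f := fun n : ℕ => (n : ℝ) * (-x) ^ n) 1).mpr h0
    simpa using this
  refine HasSum.congr_fun_eq h1.neg (fun j => ?_) ?_
  · have : Real.exp (-(2 * u) * (j + 1)) = x ^ (j + 1) := by
      rw [hxdef, ← pow_mul, ← Real.exp_nat_mul]; congr 1; push_cast; ring
    rw [this, neg_eq_neg_one_mul x, mul_pow, pow_succ (-1 : ℝ)]
    push_cast; ring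
  · have h2 : Real.exp u * Real.exp (-u) = 1 := by rw [← Real.exp_add]; simp
    have hp := Real.exp_pos (-u)
    have hp' := Real.exp_pos u
    have h7 : 1 - -x = Real.exp (-u) * (Real.exp u + Real.exp (-u)) := by
      rw [hxdef]; linear_combination -h2
    rw [h7, Real.cosh_eq, hxdef]
    field_simp
    norm_num

lemma hasSum_sq_inv_cosh_of_hasSum {h : ℝ} (hh : 0 < h) :
    ∃ d, HasSum (fun n : ℤ => (Real.cosh ((2 * n + 1) * h))⁻¹ ^ 2) (8 * d) ∧
      HasSum (fun j : ℕ => (-1) ^ j * (j + 1) * ((Real.sinh (2 * (j + 1) * h))⁻¹ / 2)) d := by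
  set F : ℕ × ℕ → ℝ := fun p =>
    (-1) ^ p.1 * (p.1 + 1) * Real.exp (-(2 * (p.1 + 1) * h) * (2 * p.2 + 1)) with hF
  have hs : Summable F := by
    refine Summable.of_norm_bounded (summable_oddMul_mul_exp hh) fun p => ?_
    have h1 : (0 : ℝ) ≤ p.1 := by positivity
    have h2 : (0 : ℝ) ≤ p.2 := by positivity
    rw [hF, norm_mul, norm_mul, norm_pow, norm_neg, norm_one, one_pow, one_mul,
      Real.norm_of_nonneg (by positivity), Real.norm_of_nonneg (Real.exp_pos _).le]
    refine mul_le_mul (by linarith [add_add_one_le_oddMul p]) (Real.exp_le_exp.mpr ?_)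
      (Real.exp_pos _).le (oddMul_pos p).le
    rw [oddMul]
    nlinarith [mul_nonneg hh.le h2]
  refine ⟨∑' p, F p, ?_, hs.hasSum.prod_fiberwise fun j => ?_⟩
  · have h1 := ((Equiv.prodComm ℕ ℕ).hasSum_iff.mpr hs.hasSum).prod_fiberwise
      (g := fun n : ℕ => (Real.cosh ((2 * n + 1) * h))⁻¹ ^ 2 / 4) fun n => by
        refine (hasSum_sq_inv_cosh (u := (2 * n + 1) * h) (by positivity)).congr_fun fun j => ?_
        simp only [Function.comp_apply, Equiv.prodComm_apply, Prod.swap_prod_mk, hF]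
        congr 2; ring
    have h2 := hasSum_int_of_hasSum_nat
      (f := fun n : ℤ => (Real.cosh ((2 * n + 1) * h))⁻¹ ^ 2)
      (fun n => by simp only [cosh_odd_neg]) ((h1.mul_left 4).congr_fun fun n => by
        push_cast; ring)
    convert h2 using 1; ring
  · exact (hasSum_exp_odd (u := 2 * (j + 1) * h) (by positivity)).mul_left _

lemma sixteen_mul_oddChi_sq {t : ℝ} (ht : 0 < t) :
    HasSum (fun j : ℕ => 4 * (1 + (-1) ^ j) * (j + 1) * (Real.sinh (2 * (j + 1) * (Real.pi * t)))⁻¹)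
      (16 * oddChi t ^ 2) := by
  have hh : 0 < Real.pi * t := mul_pos Real.pi_pos ht
  set h := Real.pi * t with hdef
  obtain ⟨d, hd1, hd2⟩ := hasSum_sq_inv_cosh_of_hasSum hh
  have hs := hasSum_inv_cosh ht
  have hprod := hs.mul hs (summable_mul_of_summable_norm hs.summable.norm hs.summable.norm)
  let e : ℤ × ℤ ≃ ℤ × ℤ :=
    { toFun := fun p => (p.2, p.2 + p.1)
      invFun := fun q => (q.2 - q.1, q.1)
      left_inv := fun p => by simp
      right_inv := fun q => by simp }
  have hV := (e.hasSum_iff.mpr hprod).prod_fiberwise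
    (g := fun k : ℤ => if k = 0 then 8 * d else 2 * k / Real.sinh (2 * k * h)) fun k => by
      split_ifs with hk
      · subst hk
        refine hd1.congr_fun fun n => ?_
        simp [e, pow_two, hdef]
      · exact hasSum_inv_cosh_mul_shift hh hk
  have h1 := (hasSum_nat_add_iff' 1).mpr hV.nat_add_neg
  have h2 := h1.add (hd2.mul_left 8)
  refine HasSum.congr_fun_eq h2 (fun j => ?_) ?_
  · have hne : ((j + 1 : ℕ) : ℤ) ≠ 0 := by omega
    simp only [hne, neg_eq_zero, if_false]
    push_cast
    rw [show 2 * -((j : ℝ) + 1) * h = -(2 * (j + 1) * h) by ring]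
    rw [Real.sinh_neg, div_neg, ← neg_div]
    ring
  · simp; ring

lemma oddChi_sq {t : ℝ} (ht : 0 < t) : oddChi t ^ 2 = oddSigma (2 * t) := by
  have hh : 0 < Real.pi * t := mul_pos Real.pi_pos ht
  have h1 := (hasSum_oddSigma (show 0 < 2 * t by positivity)).prod_fiberwise
    (g := fun i : ℕ => (2 * i + 1) * ((Real.sinh (2 * (2 * i + 1) * (Real.pi * t)))⁻¹ / 2))
    fun i => by
      refine ((hasSum_exp_odd (u := 2 * (2 * i + 1) * (Real.pi * t))
        (by positivity)).mul_left (2 * i + 1 : ℝ)).congr_fun fun j => ?_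
      rw [oddMul]; congr 2; ring
  have hinj : Function.Injective fun i : ℕ => 2 * i := fun a b h => by simpa using h
  have h2 := (hinj.hasSum_iff (fun j hj => by
    have hodd : Odd j := by
      rw [← Nat.not_even_iff_odd]
      rintro ⟨k, rfl⟩
      exact hj ⟨k, by simp only; ring⟩
    simp [hodd.neg_one_pow])).mpr (sixteen_mul_oddChi_sq ht)
  have h3 := (h1.mul_left 16).unique (h2.congr_fun fun i => by
    simp only [Function.comp_apply]
    rw [(even_two_mul i).neg_one_pow]
    push_cast; ring)
  linarith

lemma oddChi_pos {t : ℝ} (ht : 0 < t) : 0 < oddChi t := by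
  have h := (hasSum_inv_cosh_nat ht).summable.tsum_pos
    (fun j => (inv_pos.mpr (Real.cosh_pos _)).le) 0 (inv_pos.mpr (Real.cosh_pos _))
  rw [(hasSum_inv_cosh_nat ht).tsum_eq] at h
  linarith

lemma oddChi_eq {t : ℝ} (ht : 0 < t) : oddChi t = thetaTwo (2 * t) ^ 2 / 4 := by
  refine (pow_left_inj₀ (oddChi_pos ht).le (by positivity) two_ne_zero).mp ?_
  rw [oddChi_sq ht, oddSigma_eq (by positivity)]; ring

lemma eq_zero_of_forall_hasSum_pow_smul {E : Type*} [NormedAddCommGroup E] [NormedSpace ℝ E]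
    [CompleteSpace E] [FiniteDimensional ℝ E] {a : ℕ → E}
    (h : ∀ q : ℝ, 0 < q → q < 1 → HasSum (fun n => q ^ n • a n) 0) (N : ℕ) : a N = 0 := by
  induction N using Nat.strong_induction_on with
  | _ N ih =>
    have hs : ∀ q : ℝ, 0 < q → q < 1 → HasSum (fun n => q ^ n • a (n + N)) 0 := fun q h0 h1 => by
      have h2 := (hasSum_nat_add_iff' N).mpr (h q h0 h1)
      rw [Finset.sum_eq_zero (fun i hi => by rw [ih i (Finset.mem_range.mp hi), smul_zero]),
        sub_zero] at h2
      have h3 := h2.const_smul (q ^ N)⁻¹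
      rw [smul_zero] at h3
      refine h3.congr_fun fun n => ?_
      rw [smul_smul]
      congr 1
      field_simp
      ring
    have hhalf := summable_norm_iff.mpr (hs (1 / 2) (by norm_num) (by norm_num)).summable
    have hlim := tendsto_tsum_of_dominated_convergence (𝓕 := 𝓝[>] (0 : ℝ))
      (f := fun q n => q ^ n • a (n + N)) (g := fun n => (0 : ℝ) ^ n • a (n + N))
      (bound := fun n => ‖(1 / 2 : ℝ) ^ n • a (n + N)‖) hhalf (fun n => ?_) ?_
    · rw [tsum_eq_single 0 (fun n hn => by simp [hn])] at hlim
      simp only [pow_zero, one_smul, zero_add] at hlim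
      refine tendsto_nhds_unique hlim (tendsto_const_nhds.congr' ?_)
      filter_upwards [Ioo_mem_nhdsGT (one_pos (α := ℝ))] with q hq
      exact (hs q hq.1 hq.2).tsum_eq.symm
    · exact (((continuous_pow n).tendsto (0 : ℝ)).mono_left nhdsWithin_le_nhds).smul_const _
    · filter_upwards [Ioo_mem_nhdsGT (half_pos (one_pos (α := ℝ)))] with q hq n
      rw [norm_smul, norm_smul, Real.norm_of_nonneg (pow_nonneg hq.1.le n),
        Real.norm_of_nonneg (by positivity)]
      exact mul_le_mul_of_nonneg_right (pow_le_pow_left₀ hq.1.le hq.2.le n) (norm_nonneg _)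

/-- The sum of a family `a` over the fibre of `e` above `N`. -/
noncomputable def fiberSum {ι : Type*} (a : ι → ℝ) (e : ι → ℕ) (N : ℕ) : ℝ :=
  ∑' x : {x // e x = N}, a x

lemma hasSum_fiberSum {ι : Type*} {a : ι → ℝ} {e : ι → ℕ} {w : ℕ → ℝ} {s : ℝ}
    (h : HasSum (fun x => a x * w (e x)) s) : HasSum (fun N => fiberSum a e N * w N) s := by
  have h' := (Equiv.sigmaFiberEquiv e).hasSum_iff.mpr h
  refine h'.sigma fun N => ?_
  have hf := (h'.summable.sigma_factor N).hasSum
  refine HasSum.congr_fun_eq hf (fun _ => rfl) ?_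
  simp only [fiberSum]
  rw [← tsum_mul_right]
  refine tsum_congr fun x => ?_
  simp [Equiv.sigmaFiberEquiv, x.2]

lemma fiberSum_eq_of_tsum_eq {ι κ : Type*} {a : ι → ℝ} {e : ι → ℕ} {b : κ → ℝ} {f : κ → ℕ}
    (h : ∀ q : ℝ, 0 < q → q < 1 → ∃ s, HasSum (fun x => a x * q ^ e x) s ∧
      HasSum (fun y => b y * q ^ f y) s) (N : ℕ) : fiberSum a e N = fiberSum b f N := by
  refine sub_eq_zero.mp (eq_zero_of_forall_hasSum_pow_smul
    (a := fun N => fiberSum a e N - fiberSum b f N) (fun q h0 h1 => ?_) N)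
  obtain ⟨s, ha, hb⟩ := h q h0 h1
  refine HasSum.congr_fun_eq ((hasSum_fiberSum (w := fun n => q ^ n) ha).sub
    (hasSum_fiberSum (w := fun n => q ^ n) hb)) (fun n => ?_) (by ring)
  rw [smul_eq_mul]; ring

lemma Summable.mul_neg_pow {ι : Type*} {a : ι → ℝ} {e : ι → ℕ} {q : ℝ}
    (h : Summable fun x => a x * q ^ e x) : Summable fun x => a x * (-q) ^ e x := by
  refine Summable.of_norm (h.norm.congr fun x => ?_)
  simp only [norm_mul, norm_pow, norm_neg]

lemma tsum_neg_one_pow_mul_eq {ι κ : Type*} {a : ι → ℝ} {e : ι → ℕ} {b : κ → ℝ} {f : κ → ℕ}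
    (h : ∀ q : ℝ, 0 < q → q < 1 → ∃ s, HasSum (fun x => a x * q ^ e x) s ∧
      HasSum (fun y => b y * q ^ f y) s) {q : ℝ} (h0 : 0 < q) (h1 : q < 1) :
    ∑' x, a x * (-q) ^ e x = ∑' y, b y * (-q) ^ f y := by
  obtain ⟨s, ha, hb⟩ := h q h0 h1
  have ha' := hasSum_fiberSum (w := fun n => (-q) ^ n) (ha.summable.mul_neg_pow).hasSum
  have hb' := hasSum_fiberSum (w := fun n => (-q) ^ n) (hb.summable.mul_neg_pow).hasSum
  simp only [fiberSum_eq_of_tsum_eq h] at ha'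
  exact ha'.unique hb'

lemma hasSum_sq_mul_sq {u v : ℤ → ℝ} {U V : ℝ} (hu : HasSum u U) (hv : HasSum v V) :
    HasSum (fun y : (ℤ × ℤ) × (ℤ × ℤ) => u y.1.1 * u y.1.2 * (v y.2.1 * v y.2.2))
      (U ^ 2 * V ^ 2) := by
  have key : ∀ {α β : Type} {x : α → ℝ} {y : β → ℝ} {X Y : ℝ}, HasSum x X → HasSum y Y →
      HasSum (fun p : α × β => x p.1 * y p.2) (X * Y) := fun {α β x y X Y} hx hy =>
    hx.mul hy (summable_mul_of_summable_norm hx.summable.norm hy.summable.norm)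
  rw [pow_two, pow_two]
  exact key (key hu hu) (key hv hv)

lemma natAbs_sq_add_self (n : ℤ) : ((n.natAbs ^ 2 : ℕ) : ℝ) = n ^ 2 ∧
    (((n ^ 2 + n).toNat : ℕ) : ℝ) = n ^ 2 + n := by
  constructor
  · push_cast
    rw [Nat.cast_natAbs, Int.cast_abs, sq_abs]
  · have h : 0 ≤ n ^ 2 + n := by rcases le_or_gt 0 n with h | h <;> nlinarith
    have : (((n ^ 2 + n).toNat : ℤ) : ℝ) = ((n ^ 2 + n : ℤ) : ℝ) := by rw [Int.toNat_of_nonneg h]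
    push_cast at this
    exact this

lemma neg_pow_toNat_sq_add_self (q : ℝ) (n : ℤ) :
    (-q) ^ (n ^ 2 + n).toNat = q ^ (n ^ 2 + n).toNat := by
  refine Even.neg_pow ?_ q
  have h : 0 ≤ n ^ 2 + n := by rcases le_or_gt 0 n with h | h <;> nlinarith
  have : Even (((n ^ 2 + n).toNat : ℕ) : ℤ) := by
    rw [Int.toNat_of_nonneg h, pow_two, show n * n + n = n * (n + 1) by ring]
    exact Int.even_mul_succ_self n
  exact_mod_cast this

lemma neg_one_pow_natAbs_sq (n : ℤ) : ((-1 : ℝ)) ^ (n.natAbs ^ 2) = (-1) ^ n := by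
  rcases Int.even_or_odd n with h | h
  · rw [h.neg_one_zpow, Even.neg_one_pow]
    exact (Int.natAbs_even.mpr h).pow_of_ne_zero two_ne_zero
  · rw [h.neg_one_zpow, Odd.neg_one_pow]
    exact (Int.natAbs_odd.mpr h).pow

lemma hasSum_pow_toNat_sq_add_self {t : ℝ} (ht : 0 < t) :
    HasSum (fun n : ℤ => Real.exp (-(2 * Real.pi * t)) ^ (n ^ 2 + n).toNat)
      (thetaTwo (2 * t) * Real.exp (Real.pi * t / 2)) := by
  refine ((hasSum_thetaTwo (show 0 < 2 * t by positivity)).mul_right _).congr_fun fun n => ?_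
  rw [← Real.exp_add, ← Real.exp_nat_mul, (natAbs_sq_add_self n).2]
  congr 1; ring

lemma hasSum_pow_natAbs_sq {t : ℝ} (ht : 0 < t) :
    HasSum (fun n : ℤ => Real.exp (-(2 * Real.pi * t)) ^ (n.natAbs ^ 2)) (thetaThree (2 * t)) := by
  refine (hasSum_thetaThree (show 0 < 2 * t by positivity)).congr_fun fun n => ?_
  rw [← Real.exp_nat_mul, (natAbs_sq_add_self n).1]
  congr 1; ring

lemma hasSum_neg_pow_natAbs_sq {t : ℝ} (ht : 0 < t) :
    HasSum (fun n : ℤ => (-Real.exp (-(2 * Real.pi * t))) ^ (n.natAbs ^ 2))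
      (thetaFour (2 * t)) := by
  refine (hasSum_thetaFour (show 0 < 2 * t by positivity)).congr_fun fun n => ?_
  rw [neg_pow, neg_one_pow_natAbs_sq, ← Real.exp_nat_mul, (natAbs_sq_add_self n).1]
  congr 2; ring

/-- The exponent `((2i+1)(2j+1) - 1) / 2`. -/
def oddExponent (p : ℕ × ℕ) : ℕ := 2 * p.1 * p.2 + p.1 + p.2

/-- The exponent `n₁² + n₁ + n₂² + n₂ + k₁² + k₂²`. -/
def thetaExponent (y : (ℤ × ℤ) × (ℤ × ℤ)) : ℕ :=
  (y.1.1 ^ 2 + y.1.1).toNat + (y.1.2 ^ 2 + y.1.2).toNat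
    + (y.2.1.natAbs ^ 2 + y.2.2.natAbs ^ 2)

lemma exp_oddExponent (t : ℝ) (p : ℕ × ℕ) : Real.exp (-(2 * Real.pi * t)) ^ oddExponent p
    = Real.exp (-(Real.pi * t) * oddMul p) * Real.exp (Real.pi * t) := by
  rw [← Real.exp_add, ← Real.exp_nat_mul, oddMul, oddExponent]
  congr 1; push_cast; ring

lemma pow_thetaExponent (q : ℝ) (y : (ℤ × ℤ) × (ℤ × ℤ)) : q ^ thetaExponent y
    = q ^ (y.1.1 ^ 2 + y.1.1).toNat * q ^ (y.1.2 ^ 2 + y.1.2).toNat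
      * (q ^ (y.2.1.natAbs ^ 2) * q ^ (y.2.2.natAbs ^ 2)) := by
  simp only [thetaExponent, pow_add]

lemma exists_hasSum_oddExponent_thetaExponent {q : ℝ} (h0 : 0 < q) (h1 : q < 1) :
    ∃ s, HasSum (fun p : ℕ × ℕ => (2 * p.1 + 1 : ℝ) * q ^ oddExponent p) s ∧
      HasSum (fun y : (ℤ × ℤ) × (ℤ × ℤ) => (1 / 4 : ℝ) * q ^ thetaExponent y) s := by
  obtain ⟨t, ht, rfl⟩ : ∃ t, 0 < t ∧ q = Real.exp (-(2 * Real.pi * t)) := by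
    refine ⟨-Real.log q / (2 * Real.pi), ?_, ?_⟩
    · exact div_pos (neg_pos.mpr (Real.log_neg h0 h1)) Real.two_pi_pos
    · rw [mul_div_cancel₀ _ Real.two_pi_pos.ne', neg_neg, Real.exp_log h0]
  refine ⟨oddSigma t * Real.exp (Real.pi * t), ?_, ?_⟩
  · refine ((hasSum_oddSigma ht).mul_right _).congr_fun fun p => ?_
    rw [exp_oddExponent, mul_assoc]
  · refine HasSum.congr_fun_eq ((hasSum_sq_mul_sq (hasSum_pow_toNat_sq_add_self ht)
      (hasSum_pow_natAbs_sq ht)).mul_left (1 / 4)) (fun y => ?_) ?_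
    · rw [pow_thetaExponent]
    · have he : Real.exp (Real.pi * t / 2) ^ 2 = Real.exp (Real.pi * t) := by
        rw [← Real.exp_nat_mul]; congr 1; push_cast; ring
      rw [oddSigma_eq ht, show thetaTwo t ^ 4 = (thetaTwo t ^ 2) ^ 2 by ring, thetaTwo_sq ht,
        mul_pow (thetaTwo (2 * t)), he]
      ring

/-- The Lambert series `∑ χ₄(mn) m q^{mn}` over odd `m, n`, at `q = exp(-πt)`. -/
noncomputable def oddTwist (t : ℝ) : ℝ :=
  ∑' p : ℕ × ℕ, (-1) ^ (p.1 + p.2) * (2 * p.1 + 1) * Real.exp (-(Real.pi * t) * oddMul p)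

lemma oddTwist_eq {t : ℝ} (ht : 0 < t) :
    oddTwist t = thetaTwo (2 * t) ^ 2 * thetaFour (2 * t) ^ 2 / 4 := by
  have hpi := Real.pi_pos
  have h := tsum_neg_one_pow_mul_eq
    (fun q h0 h1 => exists_hasSum_oddExponent_thetaExponent (q := q) h0 h1)
    (Real.exp_pos (-(2 * Real.pi * t))) (by rw [Real.exp_lt_one_iff]; nlinarith [mul_pos hpi ht])
  have hr := (hasSum_sq_mul_sq (hasSum_pow_toNat_sq_add_self ht)
    (hasSum_neg_pow_natAbs_sq ht)).mul_left (1 / 4)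
  have hl : ∀ p : ℕ × ℕ, (2 * p.1 + 1 : ℝ) * (-Real.exp (-(2 * Real.pi * t))) ^ oddExponent p
      = (-1) ^ (p.1 + p.2) * (2 * p.1 + 1) * Real.exp (-(Real.pi * t) * oddMul p)
        * Real.exp (Real.pi * t) := fun p => by
    rw [neg_pow, exp_oddExponent, oddExponent, add_assoc, pow_add, mul_assoc 2, pow_mul,
      neg_one_sq, one_pow]
    ring
  simp only [hl, pow_thetaExponent, neg_pow_toNat_sq_add_self] at h
  rw [tsum_mul_right, ← oddTwist, hr.tsum_eq, mul_pow (thetaTwo (2 * t))] at h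
  have he : Real.exp (Real.pi * t / 2) ^ 2 = Real.exp (Real.pi * t) := by
    rw [← Real.exp_nat_mul]; congr 1; push_cast; ring
  rw [he] at h
  refine mul_right_cancel₀ (Real.exp_pos (Real.pi * t)).ne' ?_
  rw [h]; ring

lemma exp_zpow_eq_exp_int_mul (x : ℝ) (n : ℤ) : Real.exp x ^ n = Real.exp (n * x) := by
  rw [← Real.rpow_intCast, ← Real.exp_mul, mul_comm]

lemma dedekindEta_mul_I {u : ℝ} (hu : 0 < u) : dedekindEta (u * Complex.I)
    = ((Real.exp (-Real.pi * u / 12) * eulerProduct (Real.exp (-(2 * Real.pi * u))) : ℝ) : ℂ) := by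
  have h1 : Real.exp (-(2 * Real.pi * u)) < 1 := by
    rw [Real.exp_lt_one_iff]; nlinarith [mul_pos Real.pi_pos hu]
  have hI : (2 * Real.pi * Complex.I * (u * Complex.I) : ℂ) = ((-(2 * Real.pi * u) : ℝ) : ℂ) := by
    push_cast; linear_combination (2 * Real.pi * u : ℂ) * Complex.I_sq
  have hm := (multipliable_one_sub_pow_real (Real.exp_pos _) h1).map_tprod
    Complex.ofRealHom Complex.continuous_ofReal
  rw [dedekindEta, hI, eulerProduct, Complex.ofReal_mul]
  congr 1
  · rw [Complex.ofReal_exp]; congr 1; push_cast; ring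
  · refine Eq.trans (tprod_congr fun m => ?_) hm.symm
    simp

lemma thetaFour_two_mul_mul_eulerProduct {s : ℝ} (hs : 0 < s) :
    thetaFour (2 * s) * eulerProduct (Real.exp (-(2 * Real.pi * s)) ^ 2)
      = eulerProduct (Real.exp (-(2 * Real.pi * s))) ^ 2 := by
  set p := Real.exp (-(2 * Real.pi * s)) with hp
  have h0 : 0 < p := Real.exp_pos _
  have h1 : p < 1 := by
    rw [hp, Real.exp_lt_one_iff]; nlinarith [mul_pos Real.pi_pos hs]
  have h20 : 0 < p ^ 2 := by positivity
  have h21 : p ^ 2 < 1 := pow_lt_one₀ h0.le h1 two_ne_zero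
  have hE := eulerProduct_pos h20 h21
  have ht := tendsto_triple_product h0 h1 (neg_ne_zero.mpr one_ne_zero)
  have h4 : thetaFour (2 * s) = ∑' n : ℤ, (-1 : ℝ) ^ n * p ^ (n.natAbs ^ 2) := by
    rw [thetaFour_eq_tsum_pow, hp, show -Real.pi * (2 * s) = -(2 * Real.pi * s) by ring]
  rw [← h4] at ht
  have hf : ∀ N, qFactorial p (2 * N)
      = (∏ k ∈ Finset.range N, (1 - p ^ (2 * k + 1))) * qFactorial (p ^ 2) N := fun N => by
    induction N with
    | zero => simp [qFactorial]
    | succ N ih =>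
      rw [show 2 * (N + 1) = 2 * N + 1 + 1 by ring, qFactorial, Finset.prod_range_succ,
        Finset.prod_range_succ, ← qFactorial, ih, Finset.prod_range_succ, qFactorial, qFactorial,
        Finset.prod_range_succ]
      ring
  have hl := (((tendsto_qFactorial h0 h1).comp
    (tendsto_id.const_mul_atTop' (two_pos : 0 < 2))).pow 2)
  have hr := ht.mul ((tendsto_qFactorial h20 h21).pow 2)
  have := tendsto_nhds_unique hl (hr.congr fun N => ?_)
  · rw [this]; field_simp
  · simp only [Function.comp_apply, id, hf]
    rw [mul_pow, ← Finset.prod_pow]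
    congr 1
    refine Finset.prod_congr rfl fun k _ => ?_
    norm_num
    ring

lemma thetaTwo_mul_eulerProduct {s : ℝ} (hs : 0 < s) :
    thetaTwo s * eulerProduct (Real.exp (-(2 * Real.pi * s)))
      = 2 * Real.exp (-(Real.pi * s / 4)) * eulerProduct (Real.exp (-(2 * Real.pi * s)) ^ 2) ^ 2 := by
  set p := Real.exp (-(2 * Real.pi * s)) with hp
  set r := Real.exp (-(Real.pi * s)) with hr
  have hrp : r ^ 2 = p := by
    rw [hr, hp, ← Real.exp_nat_mul]; congr 1; push_cast; ring
  have hps := mul_pos Real.pi_pos hs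
  have r0 : 0 < r := Real.exp_pos _
  have r1 : r < 1 := by rw [hr, Real.exp_lt_one_iff]; linarith
  have h0 : 0 < p := Real.exp_pos _
  have h1 : p < 1 := by rw [hp, Real.exp_lt_one_iff]; linarith
  have h20 : 0 < p ^ 2 := by positivity
  have h21 : p ^ 2 < 1 := pow_lt_one₀ h0.le h1 two_ne_zero
  have hE := eulerProduct_pos h0 h1
  have hE2 := eulerProduct_pos h20 h21
  have ht := tendsto_triple_product r0 r1 r0.ne'
  rw [hrp] at ht
  have h2 : ∑' n : ℤ, r ^ n * r ^ (n.natAbs ^ 2) = thetaTwo s * Real.exp (Real.pi * s / 4) := by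
    rw [thetaTwo, ← tsum_mul_right]
    refine tsum_congr fun n => ?_
    rw [← Real.exp_add, hr, ← Real.exp_nat_mul, exp_zpow_eq_exp_int_mul, ← Real.exp_add,
      (natAbs_sq_add_self n).1]
    congr 1; ring
  rw [h2] at ht
  have hf : ∀ N, qFactorial (p ^ 2) N
      = qFactorial p N * ∏ k ∈ Finset.range N, (1 + p ^ (k + 1)) := fun N => by
    rw [qFactorial, qFactorial, ← Finset.prod_mul_distrib]
    refine Finset.prod_congr rfl fun k _ => ?_
    ring
  have hA : Tendsto (fun N => ∏ k ∈ Finset.range N, (1 + p ^ (k + 1))) atTop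
      (𝓝 (eulerProduct (p ^ 2) / eulerProduct p)) := by
    refine ((tendsto_qFactorial h20 h21).div (tendsto_qFactorial h0 h1) hE.ne').congr fun N => ?_
    simp only [Pi.div_apply]
    rw [hf, mul_div_cancel_left₀ _ (qFactorial_pos h0 h1 N).ne']
  have hone : Tendsto (fun N => 1 + p ^ N) atTop (𝓝 (1 + 0)) :=
    (tendsto_pow_atTop_nhds_zero_of_lt_one h0.le h1).const_add 1
  have hlim := (hA.mul ((hA.const_mul 2).div hone (by norm_num)))
  have := tendsto_nhds_unique ht (hlim.congr fun N => ?_)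
  · have he : Real.exp (Real.pi * s / 4) * Real.exp (-(Real.pi * s / 4)) = 1 := by
      rw [← Real.exp_add]; simp
    field_simp at this
    linear_combination Real.exp (-(Real.pi * s / 4)) * this
      - thetaTwo s * eulerProduct p * he
  · simp only [Pi.div_apply]
    have hshift : 2 * ∏ k ∈ Finset.range N, (1 + p ^ (k + 1))
        = (∏ k ∈ Finset.range N, (1 + p ^ k)) * (1 + p ^ N) := by
      rw [← Finset.prod_range_succ, Finset.prod_range_succ', pow_zero]; ring
    have hpos : 0 < 1 + p ^ N := by positivity
    rw [hshift, mul_div_cancel_right₀ _ hpos.ne', ← Finset.prod_mul_distrib]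
    refine Finset.prod_congr rfl fun k _ => ?_
    rw [← hrp]
    field_simp
    ring

/-- The cusp form `η(4τ)²η(8τ)²` at `τ = is/4`, in terms of theta constants. -/
noncomputable def cuspForm (s : ℝ) : ℝ := thetaTwo s ^ 2 * thetaFour (2 * s) ^ 2 / 4

lemma cuspForm_pos {s : ℝ} (hs : 0 < s) : 0 < cuspForm s := by
  have := thetaTwo_pos hs
  have := thetaFour_pos (show 0 < 2 * s by positivity)
  unfold cuspForm; positivity

lemma cuspForm_eq_mul_eulerProduct {s : ℝ} (hs : 0 < s) :
    cuspForm s = Real.exp (-(Real.pi * s / 2)) * eulerProduct (Real.exp (-(2 * Real.pi * s))) ^ 2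
      * eulerProduct (Real.exp (-(2 * Real.pi * s)) ^ 2) ^ 2 := by
  have e2 := thetaTwo_mul_eulerProduct hs
  have e4 := thetaFour_two_mul_mul_eulerProduct hs
  set p := Real.exp (-(2 * Real.pi * s)) with hp
  have h0 : 0 < p := Real.exp_pos _
  have h1 : p < 1 := by
    rw [hp, Real.exp_lt_one_iff]; nlinarith [mul_pos Real.pi_pos hs]
  have hE := eulerProduct_pos h0 h1
  have hE2 := eulerProduct_pos (show 0 < p ^ 2 by positivity) (pow_lt_one₀ h0.le h1 two_ne_zero)
  have he : Real.exp (-(Real.pi * s / 2)) = Real.exp (-(Real.pi * s / 4)) ^ 2 := by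
    rw [← Real.exp_nat_mul]; congr 1; push_cast; ring
  rw [cuspForm, he, eq_div_of_mul_eq hE.ne' e2, eq_div_of_mul_eq hE2.ne' e4]
  field_simp
  norm_num

lemma dedekindEta_eq_cuspForm {s : ℝ} (hs : 0 < s) :
    dedekindEta (4 * ((s / 4 : ℝ) * Complex.I)) ^ 2 * dedekindEta (8 * ((s / 4 : ℝ) * Complex.I)) ^ 2
      = (cuspForm s : ℂ) := by
  rw [show (4 * ((s / 4 : ℝ) * Complex.I) : ℂ) = (s : ℝ) * Complex.I by push_cast; ring,
    show (8 * ((s / 4 : ℝ) * Complex.I) : ℂ) = ((2 * s : ℝ) : ℂ) * Complex.I by push_cast; ring,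
    dedekindEta_mul_I hs, dedekindEta_mul_I (by positivity), cuspForm_eq_mul_eulerProduct hs,
    ← Complex.ofReal_pow, ← Complex.ofReal_pow, ← Complex.ofReal_mul]
  congr 1
  have h1 : Real.exp (-(2 * Real.pi * (2 * s))) = Real.exp (-(2 * Real.pi * s)) ^ 2 := by
    rw [← Real.exp_nat_mul]; congr 1; push_cast; ring
  have h2 : Real.exp (-(Real.pi * s / 2))
      = Real.exp (-Real.pi * s / 12) ^ 2 * Real.exp (-Real.pi * (2 * s) / 12) ^ 2 := by
    rw [← Real.exp_nat_mul, ← Real.exp_nat_mul, ← Real.exp_add]; congr 1; push_cast; ring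
  rw [h1, h2]; ring

/-- The exponent `(2n-1)² + 4b²` in the double series for the cusp form. -/
def cuspExponent (x : ℤ × ℤ) : ℕ := (2 * x.1 - 1).natAbs ^ 2 + 4 * x.2.natAbs ^ 2

/-- The coefficient `(-1)^(n-1+b) n` in the double series for the cusp form. -/
noncomputable def cuspCoeff (x : ℤ × ℤ) : ℝ := -((-1) ^ x.1 * x.1) * (-1) ^ x.2

lemma cuspExponent_cast (x : ℤ × ℤ) :
    (cuspExponent x : ℝ) = (2 * x.1 - 1) ^ 2 + 4 * x.2 ^ 2 := by
  have h1 := (natAbs_sq_add_self (2 * x.1 - 1)).1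
  have h2 := (natAbs_sq_add_self x.2).1
  rw [cuspExponent, Nat.cast_add, Nat.cast_mul, h1, h2]
  push_cast; ring

lemma cuspExponent_pos (x : ℤ × ℤ) : 0 < cuspExponent x := by
  have : 0 < (2 * x.1 - 1).natAbs := by omega
  unfold cuspExponent; positivity

lemma hasSum_cuspForm {s : ℝ} (hs : 0 < s) :
    HasSum (fun x => cuspCoeff x * Real.exp (-(Real.pi * s / 2)) ^ cuspExponent x)
      (cuspForm s) := by
  set p := Real.exp (-(2 * Real.pi * s)) with hp
  have h0 : 0 < p := Real.exp_pos _
  have h1 : p < 1 := by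
    rw [hp, Real.exp_lt_one_iff]; nlinarith [mul_pos Real.pi_pos hs]
  have hz : -p⁻¹ ≠ 0 := by simpa using h0.ne'
  have hc := eulerProduct_cube h0 h1
  have hsum := (summable_int_mul_zpow_mul_pow_sq h0 h1 hz).hasSum
  have hval : ∑' n : ℤ, (n : ℝ) * ((-p⁻¹) ^ n * p ^ (n.natAbs ^ 2)) = -eulerProduct (p ^ 2) ^ 3 := by
    rw [tsum_mul_right] at hc
    refine mul_right_cancel₀ h0.ne' ?_
    linear_combination hc
  rw [hval] at hsum
  have h4 := hasSum_thetaFour (show 0 < 2 * s by positivity)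
  have hm := (hsum.mul h4 (summable_mul_of_summable_norm hsum.summable.norm
    h4.summable.norm)).mul_left (-Real.exp (-(Real.pi * s / 2)))
  refine HasSum.congr_fun_eq hm (fun x => ?_) ?_
  · have e1 : (-p⁻¹) ^ x.1 = (-1) ^ x.1 * Real.exp (2 * Real.pi * s * x.1) := by
      rw [neg_eq_neg_one_mul, mul_zpow, hp, ← Real.exp_neg, neg_neg, exp_zpow_eq_exp_int_mul]
      congr 2; ring
    have e2 : p ^ (x.1.natAbs ^ 2) = Real.exp (-(2 * Real.pi * s) * x.1 ^ 2) := by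
      rw [hp, ← Real.exp_nat_mul, (natAbs_sq_add_self _).1]; congr 1; ring
    have e3 : Real.exp (-(Real.pi * s / 2)) ^ cuspExponent x
        = Real.exp (-(Real.pi * s / 2)) * Real.exp (2 * Real.pi * s * x.1)
          * Real.exp (-(2 * Real.pi * s) * x.1 ^ 2) * Real.exp (-Real.pi * x.2 ^ 2 * (2 * s)) := by
      rw [← Real.exp_nat_mul, cuspExponent_cast, ← Real.exp_add, ← Real.exp_add, ← Real.exp_add]
      congr 1; ring
    rw [e1, e2, e3, cuspCoeff]; ring
  · rw [cuspForm_eq_mul_eulerProduct hs]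
    have e4 := thetaFour_two_mul_mul_eulerProduct hs
    rw [← hp] at e4 ⊢
    linear_combination -Real.exp (-(Real.pi * s / 2)) * eulerProduct (p ^ 2) ^ 2 * e4

lemma fiberSum_cuspCoeff_zero : fiberSum cuspCoeff cuspExponent 0 = 0 := by
  have : IsEmpty {x // cuspExponent x = 0} := ⟨fun x => (cuspExponent_pos x).ne' x.2⟩
  simp [fiberSum]

lemma eq_fiberSum_of_dedekindEta {c : ℕ → ℂ} (hc : ∀ τ : ℂ, 0 < τ.im →
      dedekindEta (4 * τ) ^ 2 * dedekindEta (8 * τ) ^ 2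
        = ∑' n : ℕ, c (n + 1) * Complex.exp (2 * Real.pi * Complex.I * τ) ^ (n + 1)) (n : ℕ) :
    c (n + 1) = (fiberSum cuspCoeff cuspExponent (n + 1) : ℂ) := by
  refine sub_eq_zero.mp (eq_zero_of_forall_hasSum_pow_smul
    (a := fun n => c (n + 1) - (fiberSum cuspCoeff cuspExponent (n + 1) : ℂ)) (fun q h0 h1 => ?_) n)
  obtain ⟨s, hs, rfl⟩ : ∃ s, 0 < s ∧ q = Real.exp (-(Real.pi * s / 2)) := by
    refine ⟨-Real.log q * 2 / Real.pi, ?_, ?_⟩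
    · exact div_pos (mul_pos (neg_pos.mpr (Real.log_neg h0 h1)) two_pos) Real.pi_pos
    · rw [mul_div_cancel₀ _ Real.pi_pos.ne', mul_div_cancel_right₀ _ two_ne_zero, neg_neg,
        Real.exp_log h0]
  have h := hc ((s / 4 : ℝ) * Complex.I) (by simpa using hs)
  rw [dedekindEta_eq_cuspForm hs, show (2 * Real.pi * Complex.I * ((s / 4 : ℝ) * Complex.I) : ℂ)
    = ((-(Real.pi * s / 2) : ℝ) : ℂ) by
      push_cast; linear_combination (Real.pi * s / 2 : ℂ) * Complex.I_sq, ← Complex.ofReal_exp] at h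
  have hsum : Summable fun n : ℕ => c (n + 1) * (Real.exp (-(Real.pi * s / 2)) : ℂ) ^ (n + 1) := by
    by_contra hns
    rw [tsum_eq_zero_of_not_summable hns] at h
    exact (cuspForm_pos hs).ne' (by exact_mod_cast h)
  have hA := (hasSum_nat_add_iff' 1).mpr (Complex.hasSum_ofReal.mpr
    (hasSum_fiberSum (w := fun n => Real.exp (-(Real.pi * s / 2)) ^ n) (hasSum_cuspForm hs)))
  simp only [Finset.range_one, Finset.sum_singleton, fiberSum_cuspCoeff_zero, zero_mul,
    Complex.ofReal_zero, sub_zero] at hA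
  have hC := hsum.hasSum
  rw [← h] at hC
  have hD := (hC.sub hA).mul_left (Real.exp (-(Real.pi * s / 2)) : ℂ)⁻¹
  rw [sub_self, mul_zero] at hD
  refine hD.congr_fun fun n => ?_
  have hne : (Real.exp (-(Real.pi * s / 2)) : ℂ) ≠ 0 := by
    exact_mod_cast (Real.exp_pos _).ne'
  rw [Complex.real_smul]
  push_cast at hne ⊢
  field_simp
  ring

lemma integral_mul_exp_neg_mul_Ioi {k : ℝ} (hk : 0 < k) :
    ∫ s in Ioi (0 : ℝ), s * Real.exp (-(k * s)) = 1 / k ^ 2 := by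
  have h := Real.integral_rpow_mul_exp_neg_mul_Ioi (show (0 : ℝ) < 2 by norm_num) hk
  have hg : Real.Gamma 2 = 1 := by simp
  rw [hg, mul_one, Real.rpow_two, one_div_pow] at h
  rw [← h]
  refine setIntegral_congr_fun measurableSet_Ioi fun s _ => ?_
  norm_num

lemma integrableOn_mul_exp_neg_mul_Ioi {k : ℝ} (hk : 0 < k) :
    IntegrableOn (fun s => s * Real.exp (-(k * s))) (Ioi 0) :=
  Integrable.of_integral_ne_zero (by rw [integral_mul_exp_neg_mul_Ioi hk]; positivity)

lemma abs_cuspCoeff (x : ℤ × ℤ) : |cuspCoeff x| = |(x.1 : ℝ)| := by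
  rw [cuspCoeff, abs_mul, abs_neg, abs_mul, abs_neg_one_zpow, abs_neg_one_zpow, one_mul, mul_one]

lemma summable_cuspCoeff_mul_inv_sq :
    Summable fun x => cuspCoeff x * (1 / (cuspExponent x : ℝ) ^ 2) := by
  have h := (finTwoArrowEquiv ℤ).symm.summable_iff.mpr
    (EisensteinSeries.summable_one_div_norm_rpow (show (2 : ℝ) < 3 by norm_num))
  refine h.of_norm_bounded fun x => ?_
  obtain ⟨n, b⟩ := x
  simp only [Function.comp_apply, finTwoArrowEquiv_symm_apply]
  rw [norm_mul, Real.norm_eq_abs, abs_cuspCoeff, Real.norm_of_nonneg (by positivity)]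
  set M := ‖![n, b]‖ with hM
  rcases eq_or_ne n 0 with rfl | hn
  · simp only [Int.cast_zero, abs_zero, zero_mul]
    positivity
  have hnM : |(n : ℝ)| ≤ M := by
    simpa [Int.norm_eq_abs] using norm_le_pi_norm ![n, b] 0
  have hM0 : 0 < M := (abs_pos.mpr (by exact_mod_cast hn)).trans_le hnM
  have hMe : M ^ 2 ≤ cuspExponent (n, b) := by
    have hmax : M ≤ max |(n : ℝ)| |(b : ℝ)| := by
      refine (pi_norm_le_iff_of_nonneg (by positivity)).mpr fun i => ?_
      fin_cases i <;> simp [Int.norm_eq_abs]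
    have h1 : (n : ℝ) ^ 2 ≤ (2 * n - 1) ^ 2 := by
      have : n ^ 2 ≤ (2 * n - 1) ^ 2 := by
        rcases lt_or_ge n 1 with h | h <;> nlinarith
      exact_mod_cast this
    rw [cuspExponent_cast]
    refine (pow_le_pow_left₀ hM0.le hmax 2).trans ?_
    rcases max_cases |(n : ℝ)| |(b : ℝ)| with h | h <;> rw [h.1, sq_abs] <;>
      nlinarith [sq_nonneg (b : ℝ), sq_nonneg (2 * n - 1 : ℝ)]
  rw [Real.rpow_neg hM0.le, show (3 : ℝ) = (3 : ℕ) by norm_num, Real.rpow_natCast, mul_one_div,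
    div_le_iff₀ (by have := cuspExponent_pos (n, b); positivity)]
  calc |(n : ℝ)| ≤ M := hnM
    _ = (M ^ 3)⁻¹ * (M ^ 2) ^ 2 := by field_simp
    _ ≤ _ := by gcongr

lemma hasSum_integral_cuspForm :
    HasSum (fun x => cuspCoeff x * (1 / (cuspExponent x : ℝ) ^ 2))
      (Real.pi ^ 2 / 4 * ∫ s in Ioi (0 : ℝ), cuspForm s * s) := by
  have hpi := Real.pi_pos
  have hk : ∀ x, 0 < Real.pi * cuspExponent x / 2 := fun x => by
    have := cuspExponent_pos x
    positivity
  set F : ℤ × ℤ → ℝ → ℝ := fun x s =>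
    cuspCoeff x * (s * Real.exp (-(Real.pi * cuspExponent x / 2 * s))) with hF
  have hint : ∀ x, ∫ s in Ioi (0 : ℝ), F x s
      = 4 / Real.pi ^ 2 * (cuspCoeff x * (1 / (cuspExponent x : ℝ) ^ 2)) := fun x => by
    have := cuspExponent_pos x
    rw [hF, integral_const_mul, integral_mul_exp_neg_mul_Ioi (hk x)]
    field_simp
    norm_num
  have hnorm : ∀ x, ∫ s in Ioi (0 : ℝ), ‖F x s‖ = ‖∫ s in Ioi (0 : ℝ), F x s‖ := fun x => by
    rw [hF, integral_const_mul, norm_mul, integral_mul_exp_neg_mul_Ioi (hk x),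
      Real.norm_of_nonneg (show 0 ≤ 1 / (Real.pi * cuspExponent x / 2) ^ 2 by positivity),
      ← integral_mul_exp_neg_mul_Ioi (hk x), ← integral_const_mul]
    refine setIntegral_congr_fun measurableSet_Ioi fun s hs => ?_
    have : 0 < s := hs
    simp only [norm_mul, Real.norm_of_nonneg this.le, Real.norm_of_nonneg (Real.exp_pos _).le]
  have h := hasSum_integral_of_summable_integral_norm (μ := volume.restrict (Ioi (0 : ℝ))) (F := F)
    (fun x => (integrableOn_mul_exp_neg_mul_Ioi (hk x)).const_mul _) (by
      simp only [hnorm, hint]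
      exact (summable_cuspCoeff_mul_inv_sq.mul_left _).norm)
  have hform : ∫ s in Ioi (0 : ℝ), ∑' x, F x s = ∫ s in Ioi (0 : ℝ), cuspForm s * s := by
    refine setIntegral_congr_fun measurableSet_Ioi fun s hs => ?_
    rw [← ((hasSum_cuspForm hs).mul_right s).tsum_eq]
    refine tsum_congr fun x => ?_
    rw [hF, ← Real.exp_nat_mul]
    simp only
    rw [mul_comm s, ← mul_assoc]
    congr 3
    ring
  rw [hform] at h
  refine HasSum.congr_fun_eq (h.mul_left (Real.pi ^ 2 / 4)) (fun x => ?_) rfl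
  rw [hint]
  field_simp

lemma hasSum_div_sq_of_dedekindEta {c : ℕ → ℂ} (hc : ∀ τ : ℂ, 0 < τ.im →
      dedekindEta (4 * τ) ^ 2 * dedekindEta (8 * τ) ^ 2
        = ∑' n : ℕ, c (n + 1) * Complex.exp (2 * Real.pi * Complex.I * τ) ^ (n + 1)) :
    HasSum (fun n : ℕ => c (n + 1) / ((n : ℂ) + 1) ^ 2)
      ((Real.pi ^ 2 / 4 * ∫ s in Ioi (0 : ℝ), cuspForm s * s : ℝ) : ℂ) := by
  have h := (hasSum_nat_add_iff' 1).mpr (Complex.hasSum_ofReal.mpr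
    (hasSum_fiberSum (w := fun n => 1 / (n : ℝ) ^ 2) hasSum_integral_cuspForm))
  simp only [Finset.range_one, Finset.sum_singleton, fiberSum_cuspCoeff_zero, zero_mul,
    Complex.ofReal_zero, sub_zero] at h
  refine h.congr_fun fun n => ?_
  rw [eq_fiberSum_of_dedekindEta hc]
  push_cast
  ring

/-- The kernel `e^{-πMs/2 - πN/(4s)}` attached to pairs of odd numbers with products `M`, `N`. -/
noncomputable def rankinKernel (x : (ℕ × ℕ) × (ℕ × ℕ)) (s : ℝ) : ℝ :=
  Real.exp (-(Real.pi * (s / 2)) * oddMul x.1) * Real.exp (-(Real.pi * (1 / (4 * s))) * oddMul x.2)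

lemma measurable_rankinKernel (x : (ℕ × ℕ) × (ℕ × ℕ)) : Measurable (rankinKernel x) := by
  unfold rankinKernel; fun_prop

lemma rankinKernel_pos (x : (ℕ × ℕ) × (ℕ × ℕ)) (s : ℝ) : 0 < rankinKernel x s := by
  unfold rankinKernel; positivity

lemma rankinKernel_le (x : (ℕ × ℕ) × (ℕ × ℕ)) {s : ℝ} (hs : 0 < s) :
    rankinKernel x s ≤ 720 / (oddMul x.1 * oddMul x.2) ^ 3 * Real.exp (-(1 / 2) * s) := by
  have hM := one_le_oddMul x.1
  have hN := one_le_oddMul x.2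
  have hpi := Real.pi_gt_three
  set M := oddMul x.1
  set N := oddMul x.2
  set a := Real.pi * (s / 2) * M with ha
  set b := Real.pi * (1 / (4 * s)) * N with hb
  have hb0 : 0 < b := by positivity
  have has : s ≤ a := by
    rw [ha]
    nlinarith [mul_le_mul hM hpi.le (by norm_num) (by positivity)]
  set y := a / 2 + b with hy
  have hy0 : 0 < y := by positivity
  have hMN : M * N ≤ y ^ 2 := by
    have hab : a * b = Real.pi ^ 2 / 8 * (M * N) := by
      rw [ha, hb]; field_simp; norm_num
    have : 9 * (M * N) ≤ Real.pi ^ 2 * (M * N) := by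
      gcongr
      nlinarith
    nlinarith [sq_nonneg (a / 2 - b)]
  have hexp : Real.exp (-y) ≤ 720 / (M * N) ^ 3 := by
    have h6 := Real.pow_div_factorial_le_exp y hy0.le 6
    have h3 : (M * N) ^ 3 ≤ y ^ 6 := by
      calc (M * N) ^ 3 ≤ (y ^ 2) ^ 3 := by gcongr
        _ = y ^ 6 := by ring
    rw [Real.exp_neg, inv_le_comm₀ (Real.exp_pos _) (by positivity), inv_div]
    refine le_trans ?_ h6
    norm_num [Nat.factorial]
    gcongr
  calc rankinKernel x s = Real.exp (-y) * Real.exp (-(a / 2)) := by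
        rw [rankinKernel, ← Real.exp_add, ← Real.exp_add]; congr 1; rw [hy, ha, hb]; ring
    _ ≤ 720 / (M * N) ^ 3 * Real.exp (-(1 / 2) * s) := by
        gcongr
        linarith

lemma summable_inv_oddMul_sq : Summable fun p : ℕ × ℕ => 1 / oddMul p ^ 2 := by
  have h : Summable fun n : ℕ => 1 / (2 * n + 1 : ℝ) ^ 2 := by
    refine Summable.of_nonneg_of_le (fun n => by positivity) (fun n => ?_)
      ((summable_nat_add_iff 1).mpr (Real.summable_one_div_nat_pow.mpr (one_lt_two)))
    push_cast
    gcongr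
    linarith [show (0 : ℝ) ≤ n by positivity]
  refine (summable_mul_of_summable_norm h.norm h.norm).congr fun p => ?_
  rw [oddMul, mul_pow]
  field_simp

section

variable {α β : ℕ × ℕ → ℝ}

lemma norm_mul_rankinKernel_le (hα : ∀ p, |α p| ≤ oddMul p) (hβ : ∀ p, |β p| ≤ 1)
    (x : (ℕ × ℕ) × (ℕ × ℕ)) {s : ℝ} (hs : 0 < s) :
    ‖α x.1 * β x.2 * rankinKernel x s‖
      ≤ 720 * (1 / oddMul x.1 ^ 2 * (1 / oddMul x.2 ^ 2)) * Real.exp (-(1 / 2) * s) := by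
  have hM := oddMul_pos x.1
  have hN := one_le_oddMul x.2
  rw [norm_mul, norm_mul, Real.norm_eq_abs, Real.norm_eq_abs,
    Real.norm_of_nonneg (rankinKernel_pos x s).le]
  calc |α x.1| * |β x.2| * rankinKernel x s
      ≤ oddMul x.1 * 1 * (720 / (oddMul x.1 * oddMul x.2) ^ 3 * Real.exp (-(1 / 2) * s)) := by
        gcongr
        · exact (rankinKernel_pos x s).le
        · exact hα _
        · exact hβ _
        · exact rankinKernel_le x hs
    _ = 720 * (1 / oddMul x.1 ^ 2 * (1 / oddMul x.2 ^ 2 / oddMul x.2))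
          * Real.exp (-(1 / 2) * s) := by field_simp
    _ ≤ _ := by
        gcongr 720 * (1 / oddMul x.1 ^ 2 * ?_) * _
        exact div_le_self (by positivity) hN

lemma summable_inv_oddMul_sq_mul : Summable fun x : (ℕ × ℕ) × (ℕ × ℕ) =>
    720 * (1 / oddMul x.1 ^ 2 * (1 / oddMul x.2 ^ 2)) :=
  (summable_mul_of_summable_norm summable_inv_oddMul_sq.norm summable_inv_oddMul_sq.norm).mul_left _

lemma hasSum_mul_rankinKernel {A B : ℝ → ℝ}
    (hA : ∀ t, 0 < t → HasSum (fun p => α p * Real.exp (-(Real.pi * t) * oddMul p)) (A t))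
    (hB : ∀ t, 0 < t → HasSum (fun p => β p * Real.exp (-(Real.pi * t) * oddMul p)) (B t))
    {s : ℝ} (hs : 0 < s) :
    HasSum (fun x => α x.1 * β x.2 * rankinKernel x s) (A (s / 2) * B (1 / (4 * s))) := by
  have h1 := hA (s / 2) (by positivity)
  have h2 := hB (1 / (4 * s)) (by positivity)
  refine (h1.mul h2 (summable_mul_of_summable_norm h1.summable.norm
    h2.summable.norm)).congr_fun fun x => ?_
  rw [rankinKernel]; ring

lemma integrableOn_mul_rankinKernel (hα : ∀ p, |α p| ≤ oddMul p) (hβ : ∀ p, |β p| ≤ 1)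
    (x : (ℕ × ℕ) × (ℕ × ℕ)) :
    IntegrableOn (fun s => α x.1 * β x.2 * rankinKernel x s) (Ioi 0) :=
  ((exp_neg_integrableOn_Ioi 0 (half_pos one_pos)).const_mul _).mono'
    ((measurable_rankinKernel x).const_mul _).aestronglyMeasurable
    ((ae_restrict_iff' measurableSet_Ioi).mpr
      (.of_forall fun _ hs => norm_mul_rankinKernel_le hα hβ x hs))

lemma integrableOn_mul_of_hasSum (hα : ∀ p, |α p| ≤ oddMul p) (hβ : ∀ p, |β p| ≤ 1) {A B : ℝ → ℝ}
    (hA : ∀ t, 0 < t → HasSum (fun p => α p * Real.exp (-(Real.pi * t) * oddMul p)) (A t))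
    (hB : ∀ t, 0 < t → HasSum (fun p => β p * Real.exp (-(Real.pi * t) * oddMul p)) (B t)) :
    IntegrableOn (fun s => A (s / 2) * B (1 / (4 * s))) (Ioi 0) := by
  have hsum := fun {s : ℝ} (hs : 0 < s) => hasSum_mul_rankinKernel hA hB hs
  refine ((exp_neg_integrableOn_Ioi 0 (half_pos one_pos)).const_mul
    (∑' x : (ℕ × ℕ) × (ℕ × ℕ), 720 * (1 / oddMul x.1 ^ 2 * (1 / oddMul x.2 ^ 2)))).mono' ?_ ?_
  · refine aestronglyMeasurable_of_tendsto_ae atTop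
      (f := fun (t : Finset ((ℕ × ℕ) × (ℕ × ℕ))) s => ∑ x ∈ t, α x.1 * β x.2 * rankinKernel x s)
      (fun t => ?_) ((ae_restrict_iff' measurableSet_Ioi).mpr (.of_forall fun s hs => hsum hs))
    exact (Finset.measurable_sum t fun x _ =>
      (measurable_rankinKernel x).const_mul _).aestronglyMeasurable
  · refine (ae_restrict_iff' measurableSet_Ioi).mpr (.of_forall fun s hs => ?_)
    have hb := summable_inv_oddMul_sq_mul.mul_right (Real.exp (-(1 / 2) * s))
    rw [← (hsum hs).tsum_eq, ← tsum_mul_right]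
    exact tsum_of_norm_bounded hb.hasSum fun x => norm_mul_rankinKernel_le hα hβ x hs

lemma hasSum_integral_mul_rankinKernel (hα : ∀ p, |α p| ≤ oddMul p) (hβ : ∀ p, |β p| ≤ 1)
    {A B : ℝ → ℝ}
    (hA : ∀ t, 0 < t → HasSum (fun p => α p * Real.exp (-(Real.pi * t) * oddMul p)) (A t))
    (hB : ∀ t, 0 < t → HasSum (fun p => β p * Real.exp (-(Real.pi * t) * oddMul p)) (B t)) :
    HasSum (fun x => α x.1 * β x.2 * ∫ s in Ioi (0 : ℝ), rankinKernel x s)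
      (∫ s in Ioi (0 : ℝ), A (s / 2) * B (1 / (4 * s))) := by
  have hint := integrableOn_mul_rankinKernel hα hβ
  have h := hasSum_integral_of_summable_integral_norm (μ := volume.restrict (Ioi (0 : ℝ))) hint
    (Summable.of_nonneg_of_le (fun x => integral_nonneg fun s => norm_nonneg _) (fun x => ?_)
      (summable_inv_oddMul_sq_mul.mul_right (∫ s in Ioi (0 : ℝ), Real.exp (-(1 / 2) * s))))
  · refine HasSum.congr_fun_eq h (fun x => (integral_const_mul _ _).symm) ?_
    refine setIntegral_congr_fun measurableSet_Ioi fun s hs => ?_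
    exact (hasSum_mul_rankinKernel hA hB hs).tsum_eq.symm
  · rw [← integral_const_mul]
    exact setIntegral_mono_on (hint x).norm
      ((exp_neg_integrableOn_Ioi 0 (half_pos one_pos)).const_mul _) measurableSet_Ioi
      fun s hs => norm_mul_rankinKernel_le hα hβ x hs

end

/-- Exchanging the factors `2i₁+1` and `2j₁+1` of the two odd products costs a linear factor. -/
lemma integral_rankinKernel_swap (i j k l : ℕ) :
    ∫ s in Ioi (0 : ℝ), rankinKernel ((i, j), (k, l)) s
      = (2 * k + 1) / (2 * j + 1) * ∫ s in Ioi (0 : ℝ), rankinKernel ((k, i), (l, j)) s := by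
  have hk : (0 : ℝ) < 2 * k + 1 := by positivity
  have hj : (0 : ℝ) < 2 * j + 1 := by positivity
  have h := integral_comp_mul_left_Ioi' (rankinKernel ((i, j), (k, l))) 0 (div_pos hk hj)
  rw [mul_zero, smul_eq_mul] at h
  rw [← h]
  congr 1
  refine setIntegral_congr_fun measurableSet_Ioi fun s hs => ?_
  have hs' : s ≠ 0 := (ne_of_gt hs)
  simp only [rankinKernel, oddMul]
  congr 2 <;> field_simp

lemma abs_oddTwist_coeff_le (p : ℕ × ℕ) :
    |(-1 : ℝ) ^ (p.1 + p.2) * (2 * p.1 + 1)| ≤ oddMul p := by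
  rw [abs_mul, abs_neg_one_pow, one_mul, abs_of_pos (by positivity)]
  exact two_mul_add_one_le_oddMul p

lemma abs_oddLog_coeff_le (p : ℕ × ℕ) : |(1 : ℝ) / (2 * p.2 + 1)| ≤ 1 := by
  rw [abs_of_pos (by positivity)]
  exact (div_le_one (by positivity)).mpr (by linarith [show (0 : ℝ) ≤ p.2 by positivity])

lemma hasSum_oddTwist {t : ℝ} (ht : 0 < t) :
    HasSum (fun p : ℕ × ℕ => (-1) ^ (p.1 + p.2) * (2 * p.1 + 1)
      * Real.exp (-(Real.pi * t) * oddMul p)) (oddTwist t) := by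
  refine (Summable.of_norm_bounded (hasSum_oddSigma ht).summable fun p => ?_).hasSum
  rw [norm_mul, norm_mul, norm_pow, norm_neg, norm_one, one_pow, one_mul,
    Real.norm_of_nonneg (by positivity), Real.norm_of_nonneg (by positivity)]

lemma hasSum_one_div_mul_exp_oddLog {t : ℝ} (ht : 0 < t) :
    HasSum (fun p : ℕ × ℕ => (1 : ℝ) / (2 * p.2 + 1) * Real.exp (-(Real.pi * t) * oddMul p))
      (oddLog t) :=
  (hasSum_oddLog ht).congr_fun fun p => by ring

lemma integral_oddChi_mul_oddChi :
    ∫ s in Ioi (0 : ℝ), oddChi (s / 2) * oddChi (1 / (4 * s))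
      = ∫ s in Ioi (0 : ℝ), oddTwist (s / 2) * oddLog (1 / (4 * s)) := by
  have h1 := hasSum_integral_mul_rankinKernel
    (fun p => by rw [abs_neg_one_pow]; exact one_le_oddMul p)
    (fun p => (abs_neg_one_pow p.1).le) (fun t => hasSum_oddChi) (fun t => hasSum_oddChi)
  have h2 := hasSum_integral_mul_rankinKernel abs_oddTwist_coeff_le abs_oddLog_coeff_le
    (fun t => hasSum_oddTwist) (fun t => hasSum_one_div_mul_exp_oddLog)
  let e : (ℕ × ℕ) × (ℕ × ℕ) ≃ (ℕ × ℕ) × (ℕ × ℕ) :=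
    { toFun := fun x => ((x.2.1, x.1.1), (x.2.2, x.1.2))
      invFun := fun x => ((x.1.2, x.2.2), (x.1.1, x.2.1))
      left_inv := fun _ => rfl
      right_inv := fun _ => rfl }
  refine h1.unique ((e.hasSum_iff.mpr h2).congr_fun ?_)
  rintro ⟨⟨i, j⟩, k, l⟩
  rw [integral_rankinKernel_swap]
  simp only [e, Equiv.coe_fn_mk, Function.comp_apply, pow_add]
  ring

lemma integrableOn_oddTwist_mul_oddLog :
    IntegrableOn (fun s => oddTwist (s / 2) * oddLog (1 / (4 * s))) (Ioi 0) :=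
  integrableOn_mul_of_hasSum abs_oddTwist_coeff_le abs_oddLog_coeff_le
    (fun _ => hasSum_oddTwist) (fun _ => hasSum_one_div_mul_exp_oddLog)

lemma cuspForm_mul_self {s : ℝ} (hs : 0 < s) :
    cuspForm s * s = 2 * (oddChi (s / 2) * oddChi (1 / (4 * s))) := by
  rw [oddChi_eq (by positivity), oddChi_eq (by positivity), cuspForm,
    thetaFour_eq_inv (show 0 < 2 * s by positivity), div_pow, Real.sq_sqrt (by positivity),
    show 2 * (s / 2) = s by ring, show 2 * (1 / (4 * s)) = (2 * s)⁻¹ by field_simp; norm_num]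
  field_simp
  ring_nf

/-- Jacobi's identity `θ₃⁴ = θ₂⁴ + θ₄⁴`. -/
lemma thetaThree_pow_four {s : ℝ} (hs : 0 < s) :
    thetaThree s ^ 4 = thetaTwo s ^ 4 + thetaFour s ^ 4 := by
  rw [show thetaThree s ^ 4 = (thetaThree s ^ 2) ^ 2 by ring,
    show thetaTwo s ^ 4 = (thetaTwo s ^ 2) ^ 2 by ring,
    show thetaFour s ^ 4 = (thetaFour s ^ 2) ^ 2 by ring,
    thetaThree_sq hs, thetaTwo_sq hs, thetaFour_sq hs]
  ring

lemma sqrt_one_sub_thetaRatio_pow_four {s : ℝ} (hs : 0 < s) :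
    √(1 - thetaRatio s ^ 4) = thetaTwo s ^ 2 / thetaThree s ^ 2 := by
  have h3 := thetaThree_pos hs
  have h : 1 - thetaRatio s ^ 4 = (thetaTwo s ^ 2 / thetaThree s ^ 2) ^ 2 := by
    rw [thetaRatio]
    field_simp
    linear_combination thetaThree_pow_four hs
  rw [h, Real.sqrt_sq (by positivity)]

/-- The Fricke-type involution acts on `θ₄/θ₃` by `x ↦ (1 - x) / (1 + x)`. -/
lemma thetaRatio_inv {s : ℝ} (hs : 0 < s) :
    thetaRatio (1 / (4 * s)) = (1 - thetaRatio s) / (1 + thetaRatio s) := by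
  have ht : 0 < 1 / (4 * s) := by positivity
  have ha := thetaThree_add_thetaFour ht
  have hb := thetaThree_sub_thetaFour ht
  have hsq : 0 < √s⁻¹ := by positivity
  rw [show 4 * (1 / (4 * s)) = s⁻¹ by field_simp] at ha hb
  rw [thetaThree_eq_inv (inv_pos.mpr hs), inv_inv] at ha
  rw [thetaTwo_eq_inv (inv_pos.mpr hs), inv_inv] at hb
  have h3 := thetaThree_pos ht
  have h3s := thetaThree_pos hs
  have h4s := thetaFour_pos hs
  generalize √s⁻¹ = w at ha hb hsq
  field_simp at ha hb
  rw [thetaRatio, thetaRatio]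
  field_simp
  refine mul_right_cancel₀ hsq.ne' ?_
  linear_combination thetaFour s * ha - thetaThree s * hb

lemma four_mul_oddLog {s : ℝ} (hs : 0 < s) :
    4 * oddLog (1 / (4 * s)) = Real.log ((1 + thetaRatio s) / (1 - thetaRatio s)) := by
  have h := thetaRatio_inv hs
  rw [← inv_div (1 - thetaRatio s), Real.log_inv, ← h, thetaRatio,
    thetaFour_div_thetaThree (by positivity), Real.log_exp]
  ring

lemma strictMonoOn_thetaRatio : StrictMonoOn thetaRatio (Ioi 0) :=
  strictMonoOn_of_deriv_pos (convex_Ioi 0)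
    (fun _ ht => (hasDerivAt_thetaRatio ht).continuousAt.continuousWithinAt) fun t ht => by
      rw [interior_Ioi] at ht
      have := oddSigma_pos ht
      have := thetaRatio_pos ht
      have := Real.pi_pos
      rw [(hasDerivAt_thetaRatio ht).deriv]
      positivity

lemma tendsto_oddLog_atTop : Tendsto oddLog atTop (𝓝 0) := by
  have hlim : Tendsto (fun t => Real.exp (-(Real.pi * (t - 1))) * oddLog 1) atTop
      (𝓝 (0 * oddLog 1)) := by
    refine (Real.tendsto_exp_neg_atTop_nhds_zero.comp ?_).mul_const _
    exact (tendsto_atTop_add_const_right _ (-1) tendsto_id).const_mul_atTop Real.pi_pos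
  rw [zero_mul] at hlim
  refine squeeze_zero' ?_ ?_ hlim
  · filter_upwards [eventually_gt_atTop 0] with t ht using (oddLog_pos ht).le
  · filter_upwards [eventually_ge_atTop 1] with t ht
    refine hasSum_le (fun p => ?_) (hasSum_oddLog (one_pos.trans_le ht))
      ((hasSum_oddLog one_pos).mul_left _)
    rw [← mul_div_assoc, ← Real.exp_add]
    gcongr
    nlinarith [mul_nonneg (mul_nonneg Real.pi_pos.le (sub_nonneg.mpr ht))
      (sub_nonneg.mpr (one_le_oddMul p))]

lemma tendsto_thetaRatio_atTop : Tendsto thetaRatio atTop (𝓝 1) := by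
  have h := (Real.continuous_exp.tendsto _).comp (tendsto_oddLog_atTop.const_mul (-4))
  rw [mul_zero, Real.exp_zero] at h
  refine h.congr' ?_
  filter_upwards [eventually_gt_atTop 0] with t ht
  exact (thetaFour_div_thetaThree ht).symm

lemma thetaRatio_image_Ioi : thetaRatio '' Ioi 0 = Ioo 0 1 := by
  refine Subset.antisymm (image_subset_iff.mpr fun t ht =>
    ⟨thetaRatio_pos ht, thetaRatio_lt_one ht⟩) fun y hy => ?_
  have key : ∀ z < 1, ∃ t, 0 < t ∧ z < thetaRatio t := fun z hz =>
    ((eventually_gt_atTop 0).and (tendsto_thetaRatio_atTop.eventually_const_lt hz)).exists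
  obtain ⟨b, hb, hyb⟩ := key y hy.2
  obtain ⟨a, ha, hya⟩ := key ((1 - y) / (1 + y))
    ((div_lt_one (by linarith [hy.1])).mpr (by linarith [hy.1]))
  have ha' : 0 < 1 / (4 * a) := by positivity
  have hle : thetaRatio (1 / (4 * a)) ≤ y := by
    rw [thetaRatio_inv ha, div_le_iff₀ (by linarith [thetaRatio_pos ha])]
    rw [div_lt_iff₀ (by linarith [hy.1])] at hya
    linarith
  exact isPreconnected_Ioi.intermediate_value ha' hb
    (fun _ ht => (hasDerivAt_thetaRatio ht).continuousAt.continuousWithinAt) ⟨hle, hyb.le⟩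

lemma deriv_thetaRatio_smul_eq {s : ℝ} (hs : 0 < s) :
    |4 * Real.pi * oddSigma s * thetaRatio s| •
        (thetaRatio s / √(1 - thetaRatio s ^ 4)
          * Real.log ((1 + thetaRatio s) / (1 - thetaRatio s)))
      = 4 * Real.pi * (oddTwist (s / 2) * oddLog (1 / (4 * s))) := by
  have h2 := thetaTwo_pos hs
  have h3 := thetaThree_pos hs
  have hr := thetaRatio_pos hs
  have hσ := oddSigma_pos hs
  have hpi := Real.pi_pos
  rw [← four_mul_oddLog hs, sqrt_one_sub_thetaRatio_pow_four hs, abs_of_pos (by positivity),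
    oddSigma_eq hs, oddTwist_eq (by positivity), show 2 * (s / 2) = s by ring, thetaRatio,
    smul_eq_mul]
  field_simp
  norm_num

lemma integrableOn_div_sqrt_mul_log : IntegrableOn (fun x : ℝ =>
    x / Real.sqrt (1 - x ^ 4) * Real.log ((1 + x) / (1 - x))) (Ioo 0 1) := by
  rw [← thetaRatio_image_Ioi, integrableOn_image_iff_integrableOn_abs_deriv_smul measurableSet_Ioi
    (fun t ht => (hasDerivAt_thetaRatio ht).hasDerivWithinAt) strictMonoOn_thetaRatio.injOn]
  refine (integrableOn_oddTwist_mul_oddLog.const_mul (4 * Real.pi)).congr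
    ((ae_restrict_iff' measurableSet_Ioi).mpr (.of_forall fun s hs => ?_))
  exact (deriv_thetaRatio_smul_eq hs).symm

lemma integral_div_sqrt_mul_log :
    ∫ x in Ioo (0 : ℝ) 1, x / Real.sqrt (1 - x ^ 4) * Real.log ((1 + x) / (1 - x))
      = 4 * Real.pi * ∫ s in Ioi (0 : ℝ), oddTwist (s / 2) * oddLog (1 / (4 * s)) := by
  rw [← thetaRatio_image_Ioi, integral_image_eq_integral_abs_deriv_smul measurableSet_Ioi
    (fun t ht => (hasDerivAt_thetaRatio ht).hasDerivWithinAt) strictMonoOn_thetaRatio.injOn,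
    ← integral_const_mul]
  exact setIntegral_congr_fun measurableSet_Ioi fun s hs => deriv_thetaRatio_smul_eq hs

lemma integral_cuspForm_mul_self :
    Real.pi ^ 2 / 4 * ∫ s in Ioi (0 : ℝ), cuspForm s * s
      = Real.pi / 8 * ∫ x in Ioo (0 : ℝ) 1,
          x / Real.sqrt (1 - x ^ 4) * Real.log ((1 + x) / (1 - x)) := by
  rw [setIntegral_congr_fun measurableSet_Ioi fun s hs => cuspForm_mul_self hs, integral_const_mul,
    integral_oddChi_mul_oddChi, integral_div_sqrt_mul_log]
  ring

end

/-- If `c(n)` are the `q`-expansion coefficients of `η(4τ)²η(8τ)²`, then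
`Σ_{n≥1} c(n)/n² = (π/8) ∫₀¹ x/√(1-x⁴) · log((1+x)/(1-x)) dx`, the integral
converging absolutely. -/
theorem L_value_as_period (c : ℕ → ℂ)
    (hc : ∀ τ : ℂ, 0 < τ.im →
      dedekindEta (4 * τ) ^ 2 * dedekindEta (8 * τ) ^ 2
        = ∑' n : ℕ, c (n + 1) * Complex.exp (2 * Real.pi * Complex.I * τ) ^ (n + 1)) :
    Summable (fun n : ℕ => c (n + 1) / ((n : ℂ) + 1) ^ 2) ∧
    IntegrableOn (fun x : ℝ =>
      x / Real.sqrt (1 - x ^ 4) * Real.log ((1 + x) / (1 - x))) (Ioo 0 1) ∧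
    ∑' n : ℕ, c (n + 1) / ((n : ℂ) + 1) ^ 2
      = ((Real.pi / 8 * ∫ x in Ioo (0 : ℝ) 1,
          x / Real.sqrt (1 - x ^ 4) * Real.log ((1 + x) / (1 - x)) : ℝ) : ℂ) := by
  have h := hasSum_div_sq_of_dedekindEta hc
  rw [integral_cuspForm_mul_self] at h
  exact ⟨h.summable, integrableOn_div_sqrt_mul_log, h.tsum_eq⟩
end

section
/- Let a₁, b₁, a₂, b₂ : ℕ≥1 → ℂ be bounded sequences, let N > 0 be real, and let k₀, k₁, k₂ be integers. For t > 0 define G₁(t) := Σ_{m,n≥1} a₁(m)b₁(n)·n^{k₁−1}·e^{−2πmnt}, G₂(t) := Σ_{m,n≥1} a₂(m)b₂(n)·n^{k₂−1}·e^{−2πmnt}, H₁(t) := Σ_{m,n≥1} a₁(m)b₂(n)·n^{k₀−1}·e^{−2πmnt}, and H₂(t) := Σ_{m,n≥1} a₂(m)b₁(n)·n^{k₁+k₂−k₀−1}·e^{−2πmnt} (all series converge absolutely for t > 0). Then ∫₀^∞ G₁(t)·G₂(1/(Nt))·t^{k₀−k₂−1} dt = ∫₀^∞ H₁(u)·H₂(1/(Nu))·u^{k₀−k₂−1}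 du, and both integrals converge absolutely. -/
open MeasureTheory Set

/-- The double-series term `a(m)b(n)·n^{k}·e^{-2πmnt}`, with `m = p.1 + 1` and
`n = p.2 + 1` ranging over the positive integers. -/
noncomputable def eisTerm (a b : ℕ → ℂ) (k : ℤ) (t : ℝ) (p : ℕ × ℕ) : ℂ :=
  a (p.1 + 1) * b (p.2 + 1) * ((p.2 : ℂ) + 1) ^ k *
    ((Real.exp (-(2 * Real.pi) * ((p.1 : ℝ) + 1) * ((p.2 : ℝ) + 1) * t) : ℝ) : ℂ)

/-- The double series `Σ_{m,n≥1} a(m)b(n)·n^{k}·e^{-2πmnt}`. -/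
noncomputable def eisSeries (a b : ℕ → ℂ) (k : ℤ) (t : ℝ) : ℂ :=
  ∑' p : ℕ × ℕ, eisTerm a b k t p

/-- The summable weight `1 / (m² n²)`, with `m = p.1 + 1` and `n = p.2 + 1`. -/
noncomputable def eisWeight (p : ℕ × ℕ) : ℝ :=
  (((p.1 : ℝ) + 1) ^ 2)⁻¹ * (((p.2 : ℝ) + 1) ^ 2)⁻¹

/-- The terms of the product `G₁(t) G₂(1/(Nt)) t^e` of two double series. -/
noncomputable def eisProdTerm (a b c d : ℕ → ℂ) (k l e : ℤ) (N : ℝ)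
    (z : (ℕ × ℕ) × (ℕ × ℕ)) (t : ℝ) : ℂ :=
  eisTerm a b k t z.1 * eisTerm c d l (1 / (N * t)) z.2 * (t : ℂ) ^ e

/-- Exchanging the second entries of two pairs. -/
def swapSnd : (ℕ × ℕ) × (ℕ × ℕ) ≃ (ℕ × ℕ) × (ℕ × ℕ) where
  toFun z := ((z.1.1, z.2.2), (z.2.1, z.1.2))
  invFun z := ((z.1.1, z.2.2), (z.2.1, z.1.2))
  left_inv _ := rfl
  right_inv _ := rfl

lemma eisWeight_nonneg (p : ℕ × ℕ) : 0 ≤ eisWeight p := by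
  unfold eisWeight; positivity

lemma summable_eisWeight : Summable eisWeight := by
  have h : Summable fun n : ℕ => (((n : ℝ) + 1) ^ 2)⁻¹ := by
    have := (summable_nat_add_iff 1).2 (Real.summable_nat_pow_inv.2 one_lt_two)
    simpa using this
  exact h.mul_of_nonneg h (fun _ => by positivity) (fun _ => by positivity)

lemma summable_eisWeight_mul :
    Summable fun z : (ℕ × ℕ) × (ℕ × ℕ) => eisWeight z.1 * eisWeight z.2 :=
  summable_eisWeight.mul_of_nonneg summable_eisWeight eisWeight_nonneg eisWeight_nonneg

lemma exp_neg_le_factorial_mul_inv_pow {x : ℝ} (hx : 0 < x) (L : ℕ) :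
    Real.exp (-x) ≤ L.factorial * (x ^ L)⁻¹ := by
  have h := Real.pow_div_factorial_le_exp x hx.le L
  rw [Real.exp_neg, ← div_eq_mul_inv, ← inv_div]
  exact inv_anti₀ (by positivity) h

lemma zpow_mul_inv_pow_le {x : ℝ} (hx : 1 ≤ x) {k : ℤ} {L : ℕ} (hL : k + 2 ≤ L) :
    x ^ k * (x ^ L)⁻¹ ≤ (x ^ 2)⁻¹ := by
  have hx0 : x ≠ 0 := by positivity
  have h : x ^ k * (x ^ L)⁻¹ = x ^ (k - L) := by
    rw [zpow_sub₀ hx0, zpow_natCast, div_eq_mul_inv]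
  have h2 : (x ^ 2)⁻¹ = x ^ (-2 : ℤ) := by
    rw [zpow_neg]; rfl
  rw [h, h2]
  exact zpow_le_zpow_right₀ hx (by lia)

lemma exists_norm_eisTerm_le {a b : ℕ → ℂ} (ha : ∃ C : ℝ, ∀ n : ℕ, ‖a n‖ ≤ C)
    (hb : ∃ C : ℝ, ∀ n : ℕ, ‖b n‖ ≤ C) {k : ℤ} {L : ℕ} (hL : 2 ≤ L) (hkL : k + 2 ≤ L) :
    ∃ D : ℝ, 0 ≤ D ∧ ∀ t : ℝ, 0 < t → ∀ p : ℕ × ℕ,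
      ‖eisTerm a b k t p‖ ≤ D * eisWeight p * t ^ (-(L : ℤ)) := by
  obtain ⟨A, hA⟩ := ha
  obtain ⟨B, hB⟩ := hb
  have hA0 : 0 ≤ A := (norm_nonneg _).trans (hA 0)
  have hB0 : 0 ≤ B := (norm_nonneg _).trans (hB 0)
  refine ⟨A * B * L.factorial, by positivity, fun t ht p => ?_⟩
  set m : ℝ := (p.1 : ℝ) + 1 with hm
  set n : ℝ := (p.2 : ℝ) + 1 with hn
  have hm1 : 1 ≤ m := by simp [hm]
  have hn1 : 1 ≤ n := by simp [hn]
  have hnorm : ‖(p.2 : ℂ) + 1‖ = n := by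
    rw [hn, ← Complex.norm_of_nonneg (by positivity : (0 : ℝ) ≤ (p.2 : ℝ) + 1)]
    norm_cast
  have hexp : Real.exp (-(2 * Real.pi) * m * n * t) ≤
      L.factorial * ((m ^ L)⁻¹ * (n ^ L)⁻¹ * (t ^ L)⁻¹) := by
    have hx : 0 < m * n * t := by positivity
    refine le_trans (Real.exp_le_exp.2 ?_)
      ((exp_neg_le_factorial_mul_inv_pow hx L).trans_eq ?_)
    · nlinarith [Real.pi_gt_three]
    · rw [mul_pow, mul_pow, mul_inv, mul_inv]
  have hml : (m ^ L)⁻¹ ≤ (m ^ 2)⁻¹ := inv_anti₀ (by positivity) (pow_le_pow_right₀ hm1 hL)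
  have hnl := zpow_mul_inv_pow_le hn1 hkL
  calc ‖eisTerm a b k t p‖
      = ‖a (p.1 + 1)‖ * ‖b (p.2 + 1)‖ * n ^ k * Real.exp (-(2 * Real.pi) * m * n * t) := by
        rw [eisTerm, norm_mul, norm_mul, norm_mul, norm_zpow, hnorm,
          Complex.norm_of_nonneg (Real.exp_pos _).le]
    _ ≤ A * B * n ^ k * (L.factorial * ((m ^ L)⁻¹ * (n ^ L)⁻¹ * (t ^ L)⁻¹)) := by
        gcongr
        · exact hA _
        · exact hB _
    _ = A * B * L.factorial * ((m ^ L)⁻¹ * (n ^ k * (n ^ L)⁻¹)) * (t ^ L)⁻¹ := by ring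
    _ ≤ A * B * L.factorial * ((m ^ 2)⁻¹ * (n ^ 2)⁻¹) * (t ^ L)⁻¹ := by gcongr
    _ = A * B * L.factorial * eisWeight p * t ^ (-(L : ℤ)) := by
        rw [zpow_neg, zpow_natCast, eisWeight]

lemma summable_norm_eisTerm {a b : ℕ → ℂ} (ha : ∃ C : ℝ, ∀ n : ℕ, ‖a n‖ ≤ C)
    (hb : ∃ C : ℝ, ∀ n : ℕ, ‖b n‖ ≤ C) (k : ℤ) {t : ℝ} (ht : 0 < t) :
    Summable fun p => ‖eisTerm a b k t p‖ := by
  obtain ⟨D, -, hD⟩ := exists_norm_eisTerm_le ha hb (k := k) (L := k.toNat + 2)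
    (by lia) (by lia)
  exact .of_nonneg_of_le (fun _ => norm_nonneg _) (hD t ht)
    ((summable_eisWeight.mul_left D).mul_right _)

lemma exists_norm_eisProdTerm_le_zpow {a b c d : ℕ → ℂ}
    (ha : ∃ C : ℝ, ∀ n : ℕ, ‖a n‖ ≤ C) (hb : ∃ C : ℝ, ∀ n : ℕ, ‖b n‖ ≤ C)
    (hc : ∃ C : ℝ, ∀ n : ℕ, ‖c n‖ ≤ C) (hd : ∃ C : ℝ, ∀ n : ℕ, ‖d n‖ ≤ C)
    {k l : ℤ} (e : ℤ) {N : ℝ} (hN : 0 < N) {L M : ℕ} (hL : 2 ≤ L) (hkL : k + 2 ≤ L)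
    (hM : 2 ≤ M) (hlM : l + 2 ≤ M) :
    ∃ D : ℝ, 0 ≤ D ∧ ∀ t : ℝ, 0 < t → ∀ z : (ℕ × ℕ) × (ℕ × ℕ),
      ‖eisProdTerm a b c d k l e N z t‖ ≤
        D * (eisWeight z.1 * eisWeight z.2) * t ^ ((M : ℤ) - L + e) := by
  obtain ⟨D, hD0, hD⟩ := exists_norm_eisTerm_le ha hb hL hkL
  obtain ⟨E, hE0, hE⟩ := exists_norm_eisTerm_le hc hd hM hlM
  refine ⟨D * E * N ^ M, by positivity, fun t ht z => ?_⟩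
  have h₁ := hD t ht z.1
  have h₂ := hE (1 / (N * t)) (by positivity) z.2
  have hw := eisWeight_nonneg
  rw [eisProdTerm, norm_mul, norm_mul, norm_zpow, Complex.norm_of_nonneg ht.le]
  calc _ ≤ (D * eisWeight z.1 * t ^ (-(L : ℤ))) *
          (E * eisWeight z.2 * (1 / (N * t)) ^ (-(M : ℤ))) * t ^ e := by
        have := hw z.1
        gcongr
    _ = _ := by
        rw [zpow_add₀ ht.ne', sub_eq_add_neg, zpow_add₀ ht.ne', one_div, inv_zpow', neg_neg,
          mul_zpow, zpow_natCast, zpow_natCast]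
        ring

lemma exists_norm_eisProdTerm_le {a b c d : ℕ → ℂ}
    (ha : ∃ C : ℝ, ∀ n : ℕ, ‖a n‖ ≤ C) (hb : ∃ C : ℝ, ∀ n : ℕ, ‖b n‖ ≤ C)
    (hc : ∃ C : ℝ, ∀ n : ℕ, ‖c n‖ ≤ C) (hd : ∃ C : ℝ, ∀ n : ℕ, ‖d n‖ ≤ C)
    (k l e : ℤ) {N : ℝ} (hN : 0 < N) :
    ∃ D : ℝ, ∀ t : ℝ, 0 < t → ∀ z : (ℕ × ℕ) × (ℕ × ℕ),
      ‖eisProdTerm a b c d k l e N z t‖ ≤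
        D * (eisWeight z.1 * eisWeight z.2) * (1 + t ^ 2)⁻¹ := by
  obtain ⟨D, hD0, hD⟩ := exists_norm_eisProdTerm_le_zpow ha hb hc hd (k := k) (l := l) e hN
    (L := k.toNat + 2) (M := l.toNat + k.toNat + e.natAbs + 2)
    (by lia) (by lia) (by lia) (by lia)
  obtain ⟨E, hE0, hE⟩ := exists_norm_eisProdTerm_le_zpow ha hb hc hd (k := k) (l := l) e hN
    (L := k.toNat + l.toNat + e.natAbs + 4) (M := l.toNat + 2)
    (by lia) (by lia) (by lia) (by lia)
  refine ⟨2 * (D + E), fun t ht z => ?_⟩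
  have hw : 0 ≤ eisWeight z.1 * eisWeight z.2 :=
    mul_nonneg (eisWeight_nonneg _) (eisWeight_nonneg _)
  rcases le_total t 1 with h | h
  · calc _ ≤ _ := hD t ht z
      _ ≤ (D + E) * (eisWeight z.1 * eisWeight z.2) * (2 * (1 + t ^ 2)⁻¹) := by
        gcongr
        · linarith
        · refine (zpow_le_one₀ ht h (by lia)).trans ?_
          rw [← div_eq_mul_inv, one_le_div (by positivity)]
          nlinarith
      _ = _ := by ring
  · calc _ ≤ _ := hE t ht z
      _ ≤ (D + E) * (eisWeight z.1 * eisWeight z.2) * (2 * (1 + t ^ 2)⁻¹) := by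
        gcongr
        · linarith
        · refine (zpow_le_zpow_right₀ h (by lia : _ ≤ (-2 : ℤ))).trans ?_
          rw [zpow_neg, ← div_eq_mul_inv, inv_le_comm₀ (by positivity) (by positivity), inv_div,
            div_le_iff₀ two_pos]
          norm_cast
          nlinarith
      _ = _ := by ring

lemma aestronglyMeasurable_eisProdTerm (a b c d : ℕ → ℂ) (k l e : ℤ) (N : ℝ)
    (z : (ℕ × ℕ) × (ℕ × ℕ)) :
    AEStronglyMeasurable (eisProdTerm a b c d k l e N z) (volume.restrict (Ioi 0)) := by
  refine Measurable.aestronglyMeasurable ?_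
  unfold eisProdTerm eisTerm
  fun_prop

lemma hasSum_eisProdTerm {a b c d : ℕ → ℂ}
    (ha : ∃ C : ℝ, ∀ n : ℕ, ‖a n‖ ≤ C) (hb : ∃ C : ℝ, ∀ n : ℕ, ‖b n‖ ≤ C)
    (hc : ∃ C : ℝ, ∀ n : ℕ, ‖c n‖ ≤ C) (hd : ∃ C : ℝ, ∀ n : ℕ, ‖d n‖ ≤ C)
    (k l e : ℤ) {N : ℝ} (hN : 0 < N) {t : ℝ} (ht : 0 < t) :
    HasSum (fun z => eisProdTerm a b c d k l e N z t)
      (eisSeries a b k t * eisSeries c d l (1 / (N * t)) * (t : ℂ) ^ e) := by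
  have h₁ := summable_norm_eisTerm ha hb k ht
  have h₂ := summable_norm_eisTerm hc hd l (t := 1 / (N * t)) (by positivity)
  rw [eisSeries, eisSeries, tsum_mul_tsum_of_summable_norm h₁ h₂]
  exact (summable_mul_of_summable_norm h₁ h₂).hasSum.mul_right _

lemma integrableOn_and_hasSum_integral_eisProdTerm {a b c d : ℕ → ℂ}
    (ha : ∃ C : ℝ, ∀ n : ℕ, ‖a n‖ ≤ C) (hb : ∃ C : ℝ, ∀ n : ℕ, ‖b n‖ ≤ C)
    (hc : ∃ C : ℝ, ∀ n : ℕ, ‖c n‖ ≤ C) (hd : ∃ C : ℝ, ∀ n : ℕ, ‖d n‖ ≤ C)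
    (k l e : ℤ) {N : ℝ} (hN : 0 < N) :
    IntegrableOn (fun t : ℝ =>
      eisSeries a b k t * eisSeries c d l (1 / (N * t)) * (t : ℂ) ^ e) (Ioi 0) ∧
    HasSum (fun z => ∫ t in Ioi (0 : ℝ), eisProdTerm a b c d k l e N z t)
      (∫ t in Ioi (0 : ℝ),
        eisSeries a b k t * eisSeries c d l (1 / (N * t)) * (t : ℂ) ^ e) := by
  obtain ⟨D, hD⟩ := exists_norm_eisProdTerm_le ha hb hc hd k l e hN
  have hmeas := aestronglyMeasurable_eisProdTerm a b c d k l e N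
  have hsum : ∀ᵐ t ∂(volume.restrict (Ioi (0 : ℝ))),
      HasSum (fun z => eisProdTerm a b c d k l e N z t)
        (eisSeries a b k t * eisSeries c d l (1 / (N * t)) * (t : ℂ) ^ e) :=
    ae_restrict_of_forall_mem measurableSet_Ioi fun t ht =>
      hasSum_eisProdTerm ha hb hc hd k l e hN ht
  have hw (t : ℝ) : Summable fun z : (ℕ × ℕ) × (ℕ × ℕ) =>
      D * (eisWeight z.1 * eisWeight z.2) * (1 + t ^ 2)⁻¹ :=
    (summable_eisWeight_mul.mul_left D).mul_right _
  have hint : IntegrableOn (fun t : ℝ => ∑' z : (ℕ × ℕ) × (ℕ × ℕ),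
      D * (eisWeight z.1 * eisWeight z.2) * (1 + t ^ 2)⁻¹) (Ioi 0) := by
    simp_rw [tsum_mul_right]
    exact (integrable_inv_one_add_sq.const_mul _).integrableOn
  refine ⟨hint.mono' (aestronglyMeasurable_of_tendsto_ae Filter.atTop
      (fun s => Finset.aestronglyMeasurable_fun_sum s fun z _ => hmeas z) hsum) ?_,
    hasSum_integral_of_dominated_convergence _ hmeas
      (fun z => ae_restrict_of_forall_mem measurableSet_Ioi fun t ht => hD t ht z)
      (.of_forall hw) hint hsum⟩
  filter_upwards [hsum, ae_restrict_mem measurableSet_Ioi] with t h ht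
  rw [← h.tsum_eq]
  exact tsum_of_norm_bounded (hw t).hasSum (hD t ht)

/-- The substitution `t = (n₂ / n₁) u` in the integral of a single term. -/
lemma integral_eisProdTerm_swapSnd (a₁ b₁ a₂ b₂ : ℕ → ℂ) {N : ℝ} (hN : 0 < N) (k₀ k₁ k₂ : ℤ)
    (z : (ℕ × ℕ) × (ℕ × ℕ)) :
    ∫ t in Ioi (0 : ℝ),
        eisProdTerm a₁ b₁ a₂ b₂ (k₁ - 1) (k₂ - 1) (k₀ - k₂ - 1) N z t =
      ∫ u in Ioi (0 : ℝ), eisProdTerm a₁ b₂ a₂ b₁ (k₀ - 1) (k₁ + k₂ - k₀ - 1) (k₀ - k₂ - 1) N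
        (swapSnd z) u := by
  obtain ⟨⟨m₁, n₁⟩, ⟨m₂, n₂⟩⟩ := z
  have hn₁ : (0 : ℝ) < (n₁ : ℝ) + 1 := by positivity
  have hn₂ : (0 : ℝ) < (n₂ : ℝ) + 1 := by positivity
  have hc : (0 : ℝ) < ((n₂ : ℝ) + 1) / ((n₁ : ℝ) + 1) := by positivity
  have key := integral_comp_mul_left_Ioi
    (eisProdTerm a₁ b₁ a₂ b₂ (k₁ - 1) (k₂ - 1) (k₀ - k₂ - 1) N ((m₁, n₁), (m₂, n₂))) 0 hc
  rw [mul_zero, eq_inv_smul_iff₀ hc.ne', ← integral_smul] at key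
  rw [← key]
  refine setIntegral_congr_fun measurableSet_Ioi fun u (hu : 0 < u) => ?_
  have e₁ : -(2 * Real.pi) * ((m₁ : ℝ) + 1) * ((n₁ : ℝ) + 1) *
      (((n₂ : ℝ) + 1) / ((n₁ : ℝ) + 1) * u) =
      -(2 * Real.pi) * ((m₁ : ℝ) + 1) * ((n₂ : ℝ) + 1) * u := by
    field_simp
  have e₂ : -(2 * Real.pi) * ((m₂ : ℝ) + 1) * ((n₂ : ℝ) + 1) *
      (1 / (N * (((n₂ : ℝ) + 1) / ((n₁ : ℝ) + 1) * u))) =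
      -(2 * Real.pi) * ((m₂ : ℝ) + 1) * ((n₁ : ℝ) + 1) * (1 / (N * u)) := by
    field_simp
  have hx : (n₁ : ℂ) + 1 ≠ 0 := by exact_mod_cast hn₁.ne'
  have hy : (n₂ : ℂ) + 1 ≠ 0 := by exact_mod_cast hn₂.ne'
  have hpow : ((n₂ : ℂ) + 1) / ((n₁ : ℂ) + 1) * (((n₁ : ℂ) + 1) ^ (k₁ - 1) *
      ((n₂ : ℂ) + 1) ^ (k₂ - 1) * (((n₂ : ℂ) + 1) / ((n₁ : ℂ) + 1)) ^ (k₀ - k₂ - 1)) =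
      ((n₂ : ℂ) + 1) ^ (k₀ - 1) * ((n₁ : ℂ) + 1) ^ (k₁ + k₂ - k₀ - 1) := by
    rw [div_zpow]
    simp only [zpow_sub₀ hx, zpow_sub₀ hy, zpow_add₀ hx, zpow_one]
    field_simp
  simp only [eisProdTerm, eisTerm, swapSnd, Equiv.coe_fn_mk, e₁, e₂, Complex.real_smul]
  push_cast
  rw [mul_zpow]
  linear_combination (a₁ (m₁ + 1) * b₁ (n₁ + 1) * a₂ (m₂ + 1) * b₂ (n₂ + 1) *
    Complex.exp (-(2 * Real.pi) * ((m₁ : ℂ) + 1) * ((n₂ : ℂ) + 1) * u) *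
    Complex.exp (-(2 * Real.pi) * ((m₂ : ℂ) + 1) * ((n₁ : ℂ) + 1) * (1 / (N * u))) *
    (u : ℂ) ^ (k₀ - k₂ - 1)) * hpow

/-- With `G₁(t) = Σ a₁(m)b₁(n) n^{k₁-1} e^{-2πmnt}`,
`G₂(t) = Σ a₂(m)b₂(n) n^{k₂-1} e^{-2πmnt}`,
`H₁(t) = Σ a₁(m)b₂(n) n^{k₀-1} e^{-2πmnt}`, and
`H₂(t) = Σ a₂(m)b₁(n) n^{k₁+k₂-k₀-1} e^{-2πmnt}` (all four double series
converging absolutely for every `t > 0`), one has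
`∫₀^∞ G₁(t)G₂(1/(Nt)) t^{k₀-k₂-1} dt = ∫₀^∞ H₁(u)H₂(1/(Nu)) u^{k₀-k₂-1} du`,
and both integrals converge absolutely. -/
theorem eisenstein_series_integral_transformation (a₁ b₁ a₂ b₂ : ℕ → ℂ)
    (ha₁ : ∃ C : ℝ, ∀ n : ℕ, ‖a₁ n‖ ≤ C) (hb₁ : ∃ C : ℝ, ∀ n : ℕ, ‖b₁ n‖ ≤ C)
    (ha₂ : ∃ C : ℝ, ∀ n : ℕ, ‖a₂ n‖ ≤ C) (hb₂ : ∃ C : ℝ, ∀ n : ℕ, ‖b₂ n‖ ≤ C)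
    (N : ℝ) (hN : 0 < N) (k₀ k₁ k₂ : ℤ) :
    (∀ t : ℝ, 0 < t →
      Summable (eisTerm a₁ b₁ (k₁ - 1) t) ∧ Summable (eisTerm a₂ b₂ (k₂ - 1) t) ∧
      Summable (eisTerm a₁ b₂ (k₀ - 1) t) ∧
      Summable (eisTerm a₂ b₁ (k₁ + k₂ - k₀ - 1) t)) ∧
    IntegrableOn (fun t : ℝ =>
      eisSeries a₁ b₁ (k₁ - 1) t * eisSeries a₂ b₂ (k₂ - 1) (1 / (N * t)) *
        ((t : ℂ) ^ (k₀ - k₂ - 1))) (Ioi 0) ∧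
    IntegrableOn (fun u : ℝ =>
      eisSeries a₁ b₂ (k₀ - 1) u * eisSeries a₂ b₁ (k₁ + k₂ - k₀ - 1) (1 / (N * u)) *
        ((u : ℂ) ^ (k₀ - k₂ - 1))) (Ioi 0) ∧
    ∫ t in Ioi (0 : ℝ),
        eisSeries a₁ b₁ (k₁ - 1) t * eisSeries a₂ b₂ (k₂ - 1) (1 / (N * t)) *
          ((t : ℂ) ^ (k₀ - k₂ - 1))
      = ∫ u in Ioi (0 : ℝ),
          eisSeries a₁ b₂ (k₀ - 1) u * eisSeries a₂ b₁ (k₁ + k₂ - k₀ - 1) (1 / (N * u)) *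
            ((u : ℂ) ^ (k₀ - k₂ - 1)) := by
  obtain ⟨hG, hGsum⟩ := integrableOn_and_hasSum_integral_eisProdTerm ha₁ hb₁ ha₂ hb₂
    (k₁ - 1) (k₂ - 1) (k₀ - k₂ - 1) hN
  obtain ⟨hH, hHsum⟩ := integrableOn_and_hasSum_integral_eisProdTerm ha₁ hb₂ ha₂ hb₁
    (k₀ - 1) (k₁ + k₂ - k₀ - 1) (k₀ - k₂ - 1) hN
  refine ⟨fun t ht => ⟨(summable_norm_eisTerm ha₁ hb₁ _ ht).of_norm,
    (summable_norm_eisTerm ha₂ hb₂ _ ht).of_norm, (summable_norm_eisTerm ha₁ hb₂ _ ht).of_norm,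
    (summable_norm_eisTerm ha₂ hb₁ _ ht).of_norm⟩, hG, hH, ?_⟩
  simp_rw [integral_eisProdTerm_swapSnd a₁ b₁ a₂ b₂ hN k₀ k₁ k₂] at hGsum
  exact hGsum.unique (swapSnd.hasSum_iff.2 hHsum)
end
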